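/- Let d ≥ 2 and D = C(d+2,2). Let w = (w_1,…,w_D) ∈ ℂ^D have rational rank D and be a point of L_{d,d+2}. Suppose there is a generic configuration p of n points in ℝ^d (or simply one such that l(p) is generic in L_{d,n}) and D non-negative rational length functionals γ_1,…,γ_D such that w_i = ⟨γ_i, p⟩ for all i. Then there exists a (d+2)-point subconfiguration p_T of p and a positive scale factor s such that ⟨γ⃗, p⟩ = w = s·l(p_T); moreover the data w determines p_T up to a similarity transform of ℝ^d. -/

import Mathlib

/-- A (complex embedded affine) algebraic variety: the common zero set of a
finite collection of polynomials. -/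
def IsVariety {ι : Type*} (V : Set (ι → ℂ)) : Prop :=
  ∃ S : Finset (MvPolynomial ι ℂ), V = {x | ∀ f ∈ S, MvPolynomial.eval x f = 0}

/-- A variety defined over ℚ: cut out by polynomials with rational coefficients. -/
def IsQVariety {ι : Type*} (V : Set (ι → ℂ)) : Prop :=
  ∃ S : Finset (MvPolynomial ι ℚ), V = {x | ∀ f ∈ S, MvPolynomial.aeval x f = 0}

/-- An irreducible variety: a nonempty variety that is not a union of two proper
subvarieties. -/
def IsIrrVariety {ι : Type*} (V : Set (ι → ℂ)) : Prop :=
  IsVariety V ∧ V.Nonempty ∧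
    ∀ V₁ V₂ : Set (ι → ℂ), IsVariety V₁ → IsVariety V₂ → V = V₁ ∪ V₂ → (V = V₁ ∨ V = V₂)

/-- A generic point of a variety `V`: a point of `V` whose coordinates satisfy no
polynomial equation with rational coefficients except those satisfied by every
point of `V`. -/
def IsGenericPt {ι : Type*} (V : Set (ι → ℂ)) (x : ι → ℂ) : Prop :=
  x ∈ V ∧ ∀ f : MvPolynomial ι ℚ, MvPolynomial.aeval x f = 0 →
    ∀ y ∈ V, MvPolynomial.aeval y f = 0
/-- Edges of the complete graph `K_n`: unordered pairs of distinct vertices.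
There are `N = C(n,2)` of them, and they index the coordinates of `ℂ^N`. -/
abbrev Edge (n : ℕ) : Type := {e : Sym2 (Fin n) // ¬ e.IsDiag}

/-- Complex squared length along an edge: `m_ij(p) = Σ_k (p_i^k − p_j^k)²`
(complex squares, no conjugation). -/
noncomputable def cSqLen {n d : ℕ} (p : Fin n → Fin d → ℂ) : Sym2 (Fin n) → ℂ :=
  Sym2.lift ⟨fun i j => ∑ k, (p i k - p j k) ^ 2,
    fun i j => Finset.sum_congr rfl fun k _ => by ring⟩

/-- The squared measurement variety `M_{d,n}`: the image of the squared
measurement map over all complex configurations of `n` points in ℂ^d. -/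
def Mvar (d n : ℕ) : Set (Edge n → ℂ) :=
  {w | ∃ p : Fin n → Fin d → ℂ, ∀ e : Edge n, w e = cSqLen p e.val}

/-- The coordinate-wise squaring map `s`. -/
def sqMap {n : ℕ} (w : Edge n → ℂ) : Edge n → ℂ := fun e => w e ^ 2

/-- The unsquared measurement variety `L_{d,n} = s⁻¹(M_{d,n})`. -/
def Lvar (d n : ℕ) : Set (Edge n → ℂ) := sqMap ⁻¹' Mvar d n

/-- Euclidean distance between two points of ℝ^d. -/
noncomputable def eudist {d : ℕ} (x y : Fin d → ℝ) : ℝ :=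
  Real.sqrt (∑ k, (x k - y k) ^ 2)

/-- Euclidean length along an edge of a real configuration. -/
noncomputable def lenR {n d : ℕ} (p : Fin n → Fin d → ℝ) : Sym2 (Fin n) → ℝ :=
  Sym2.lift ⟨fun i j => eudist (p i) (p j),
    fun i j => congrArg Real.sqrt (Finset.sum_congr rfl fun k _ => by ring)⟩

/-- A generic configuration of `n` points in ℝ^d. -/
def GenericConfig {n d : ℕ} (p : Fin n → Fin d → ℝ) : Prop :=
  ∀ f : MvPolynomial (Fin n × Fin d) ℚ, f ≠ 0 →
    MvPolynomial.aeval (fun ik : Fin n × Fin d => p ik.1 ik.2) f ≠ 0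

/-- A similarity of ℝ^d: a bijection scaling all distances by a fixed positive
ratio. -/
def IsSimilarity {d : ℕ} (f : (Fin d → ℝ) → (Fin d → ℝ)) : Prop :=
  Function.Bijective f ∧ ∃ r : ℝ, 0 < r ∧ ∀ x y, eudist (f x) (f y) = r * eudist x y

section
namespace CIC
set_option linter.unusedSimpArgs false
open MvPolynomial

theorem chain {σ A : Type*} [Fintype σ] [CommRing A] [Algebra ℝ A] (D : Derivation ℝ A A)
    (g : σ → A) (f : MvPolynomial σ ℝ) :
    D (aeval g f) = ∑ i, aeval g (pderiv i f) * D (g i) := by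
  classical
  induction f using MvPolynomial.induction_on with
  | C a => simp
  | add p q hp hq => simp [hp, hq, add_mul, Finset.sum_add_distrib]
  | mul_X p i hp =>
    simp only [map_mul, aeval_X, Derivation.leibniz, hp, smul_eq_mul, pderiv_X, map_add, add_mul,
      Finset.sum_add_distrib]
    congr 1
    · rw [Finset.sum_eq_single i]
      · simp
      · intro b _ hb
        simp [hb]
      · simp
    · rw [Finset.mul_sum]
      exact Finset.sum_congr rfl fun _ _ => by ring

theorem zero_of_sq {σ : Type*} [Fintype σ] (f : MvPolynomial σ ℝ)
    (h : ∀ y : σ → ℝ, (∀ i, y i ≠ 0) → eval (fun i => y i ^ 2) f = 0) : f = 0 := by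
  have h1 : (∏ i, X i) * expand 2 f = 0 := by
    apply MvPolynomial.funext
    intro y
    simp only [map_mul, eval_prod, eval_X, map_zero]
    by_cases hy : ∀ i, y i ≠ 0
    · have : eval y (expand 2 f) = eval (fun i => y i ^ 2) f := eval_expand _ _ _
      rw [this, h y hy, mul_zero]
    · push Not at hy
      obtain ⟨i, hi⟩ := hy
      rw [Finset.prod_eq_zero (Finset.mem_univ i) hi, zero_mul]
  rcases mul_eq_zero.1 h1 with h2 | h2
  · exact absurd h2 (Finset.prod_ne_zero_iff.2 fun i _ => X_ne_zero i)
  · rwa [expand_eq_zero (by norm_num)] at h2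

theorem eval_poly {σ : Type*} (g : σ → Polynomial ℝ) (f : MvPolynomial σ ℝ) (t : ℝ) :
    (aeval g f).eval t = eval (fun i => (g i).eval t) f := by
  induction f using MvPolynomial.induction_on with
  | C a => simp
  | add p q hp hq => simp [hp, hq]
  | mul_X p i hp => simp [hp]

theorem eval_aeval {σ τ : Type*} (g : σ → MvPolynomial τ ℝ) (f : MvPolynomial σ ℝ) (t : τ → ℝ) :
    eval t (aeval g f) = eval (fun i => eval t (g i)) f := by
  induction f using MvPolynomial.induction_on with
  | C a => simp
  | add p q hp hq => rw [map_add, map_add, map_add, hp, hq]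
  | mul_X p i hp => rw [map_mul, map_mul, map_mul, hp, aeval_X, eval_X]

theorem poly_deriv {σ : Type*} [Fintype σ] (g : σ → Polynomial ℝ) (f : MvPolynomial σ ℝ) (t : ℝ) :
    (Polynomial.derivative (aeval g f)).eval t =
      ∑ i, eval (fun i => (g i).eval t) (pderiv i f) * (Polynomial.derivative (g i)).eval t := by
  have := chain (Polynomial.derivative' (R := ℝ)) g f
  simp only [Polynomial.derivative'_apply] at this
  rw [this]
  simp [Polynomial.eval_finsetSum, eval_poly]

theorem line_const {σ : Type*} [Fintype σ] (f : MvPolynomial σ ℝ) (y v : σ → ℝ) (c : ℝ)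
    (h : ∀ t : ℝ, eval (fun i => y i + t * v i) f = c) :
    ∑ i, v i * eval y (pderiv i f) = 0 := by
  have h1 : aeval (fun i => Polynomial.C (y i) + Polynomial.X * Polynomial.C (v i)) f
      = Polynomial.C c := by
    apply Polynomial.funext
    intro t
    rw [eval_poly]
    have := h t
    simp only [mul_comm t] at this
    simpa using this
  have h2 := poly_deriv (fun i => Polynomial.C (y i) + Polynomial.X * Polynomial.C (v i)) f 0
  rw [h1] at h2
  simp at h2
  rw [h2]
  exact Finset.sum_congr rfl fun _ _ => mul_comm _ _

theorem coeff_kill {σ : Type*} [DecidableEq σ] (s : Finset σ) (a : σ →₀ ℕ) (ha : a.support ⊆ s)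
    (h : MvPolynomial σ ℝ) :
    coeff a (aeval (fun i => if i ∈ s then X i else 0 : σ → MvPolynomial σ ℝ) h) = coeff a h := by
  induction h using MvPolynomial.induction_on' with
  | add p q hp hq => rw [map_add, coeff_add, coeff_add, hp, hq]
  | monomial b c =>
    rw [aeval_monomial]
    by_cases hb : b.support ⊆ s
    · have : (b.prod fun i k => (if i ∈ s then X i else 0 : MvPolynomial σ ℝ) ^ k) =
          b.prod fun i k => (X i : MvPolynomial σ ℝ) ^ k := by
        apply Finset.prod_congr rfl
        intro i hi
        simp [hb hi]
      rw [this, monomial_eq (s := b)]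
      rfl
    · obtain ⟨i, hi, hs⟩ := Finset.not_subset.1 hb
      have : (b.prod fun i k => (if i ∈ s then X i else 0 : MvPolynomial σ ℝ) ^ k) = 0 := by
        apply Finset.prod_eq_zero hi
        simp only [if_neg hs]
        exact zero_pow (Finsupp.mem_support_iff.1 hi)
      rw [this, mul_zero, coeff_zero, coeff_monomial, if_neg]
      rintro rfl
      exact hb ha

theorem vlem {σ : Type*} (h : MvPolynomial σ ℝ) (d : ℕ)
    (H : ∀ (s : Finset σ) (τ : σ → ℝ), s.card ≤ d → (∀ i, i ∉ s → τ i = 0) →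
      eval (fun i => τ i ^ 2) h = 0) (a : σ →₀ ℕ) (ha : a.support.card ≤ d) : coeff a h = 0 := by
  classical
  have h1 : expand 2 (aeval (fun i => if i ∈ a.support then X i else 0 : σ → MvPolynomial σ ℝ) h)
      = 0 := by
    apply MvPolynomial.funext
    intro y
    rw [eval_expand, eval_aeval, map_zero]
    rw [← H a.support (fun i => if i ∈ a.support then y i else 0) ha (fun i hi => if_neg hi)]
    congr 2
    funext i
    by_cases hi : i ∈ a.support
    · rw [if_pos hi, if_pos hi]; simp
    · rw [if_neg hi, if_neg hi]; simp
  rw [expand_eq_zero (by norm_num)] at h1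
  rw [← coeff_kill a.support a (Finset.Subset.refl _), h1, coeff_zero]

/-- squared difference along an edge -/
def dl {R : Type*} [CommRing R] {n : ℕ} (u : Fin n → R) (e : Edge n) : R :=
  Sym2.lift ⟨fun i j => (u i - u j) ^ 2, fun i j => by ring⟩ e.1

/-- squared lengths -/
def sqm {R κ : Type*} [CommRing R] [Fintype κ] {n : ℕ} (q : Fin n → κ → R) (e : Edge n) : R :=
  ∑ k, dl (fun i => q i k) e

theorem dl_smul {R : Type*} [CommRing R] {n : ℕ} (c : R) (u : Fin n → R) (e : Edge n) :
    dl (fun i => c * u i) e = c ^ 2 * dl u e := by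
  obtain ⟨⟨i, j⟩, he⟩ := e
  change (c * u i - c * u j) ^ 2 = c ^ 2 * (u i - u j) ^ 2
  ring

theorem dl_zero {R : Type*} [CommRing R] {n : ℕ} (e : Edge n) :
    dl (fun _ => 0 : Fin n → R) e = 0 := by
  obtain ⟨⟨i, j⟩, he⟩ := e
  change ((0 : R) - 0) ^ 2 = 0
  ring

theorem sum_embed {κ ι : Type*} [Fintype κ] [Fintype ι] {n : ℕ} (s : Finset ι)
    (hs : s.card ≤ Fintype.card κ) (u : ι → Fin n → ℝ) (hu : ∀ i, i ∉ s → u i = fun _ => 0) :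
    ∃ q : Fin n → κ → ℝ, ∀ e, sqm q e = ∑ i, dl (u i) e := by
  classical
  obtain ⟨g⟩ : Nonempty (s ↪ κ) := by
    apply Function.Embedding.nonempty_of_card_le
    simpa using hs
  refine ⟨fun a k => Function.extend g (fun i : s => u i a) 0 k, fun e => ?_⟩
  rw [sqm]
  have h1 : ∑ i, dl (u i) e = ∑ i : s, dl (u i) e := by
    symm
    rw [Finset.sum_coe_sort s (fun i => dl (u i) e)]
    apply Finset.sum_subset (Finset.subset_univ _)
    intro i _ hi
    rw [hu i hi, dl_zero]
  rw [h1]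
  symm
  apply Fintype.sum_of_injective g g.injective
  · intro k hk
    have : (fun i => Function.extend g (fun i_1 : s => u i_1 i) 0 k) = fun _ => (0 : ℝ) := by
      funext i
      rw [Function.extend_apply' _ _ _ (by simpa using hk)]
      rfl
    rw [this, dl_zero]
  · intro i
    congr 1
    funext a
    rw [g.injective.extend_apply]

theorem span_dl {n : ℕ} (e : Edge n) : ∃ t : Fin n × Fin n → ℝ, ∀ f : Edge n,
    ∑ w, t w * dl (fun i => if i = w.1 ∨ i = w.2 then (1 : ℝ) else 0) f = if f = e then 1 else 0 := by
  obtain ⟨⟨i, j⟩, he⟩ := e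
  have hij : i ≠ j := by simpa using he
  refine ⟨fun w => (if w = (i, i) then 1/2 else 0) + (if w = (j, j) then 1/2 else 0)
    - (if w = (i, j) then 1/2 else 0), ?_⟩
  rintro ⟨⟨a, b⟩, hf⟩
  have hab : a ≠ b := by simpa using hf
  simp only [sub_mul, add_mul, Finset.sum_sub_distrib, Finset.sum_add_distrib, ite_mul, zero_mul,
    Finset.sum_ite_eq', Finset.mem_univ, if_true]
  change 1/2 * ((if a = i ∨ a = i then (1:ℝ) else 0) - (if b = i ∨ b = i then (1:ℝ) else 0)) ^ 2
    + 1/2 * ((if a = j ∨ a = j then (1:ℝ) else 0) - (if b = j ∨ b = j then (1:ℝ) else 0)) ^ 2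
    - 1/2 * ((if a = i ∨ a = j then (1:ℝ) else 0) - (if b = i ∨ b = j then (1:ℝ) else 0)) ^ 2 = _
  have : ((⟨Sym2.mk a b, hf⟩ : Edge n) = ⟨Sym2.mk i j, he⟩) ↔ (a = i ∧ b = j) ∨ (a = j ∧ b = i) := by
    rw [Subtype.mk.injEq]
    exact Sym2.eq_iff
  simp only [this, or_self_iff]
  by_cases h1 : a = i <;> by_cases h2 : a = j <;> by_cases h3 : b = i <;> by_cases h4 : b = j <;>
    first
    | (simp only [h1, h2, h3, h4, if_true, if_false, or_true, true_or, and_self, false_or,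
        or_false, false_and, and_false, hij, hij.symm]; norm_num; done)
    | (exfalso; simp_all; done)

theorem surj_dl {n : ℕ} (m : Edge n → ℝ) : ∃ t : Fin n × Fin n → ℝ, ∀ f : Edge n,
    ∑ w, t w * dl (fun i => if i = w.1 ∨ i = w.2 then (1 : ℝ) else 0) f = m f := by
  classical
  choose t ht using fun e : Edge n => span_dl e
  refine ⟨fun w => ∑ e, m e * t e w, fun f => ?_⟩
  simp only [Finset.sum_mul]
  rw [Finset.sum_comm]
  simp only [mul_assoc, ← Finset.mul_sum, ht]
  simp

/-- low degree polynomials vanishing on M vanish -/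
theorem dgl {n k : ℕ} {κ : Type*} [Fintype κ] (f : MvPolynomial (Edge n) ℝ) (hf : f.IsHomogeneous k)
    (hk : k ≤ Fintype.card κ) (H : ∀ q : Fin n → κ → ℝ, eval (sqm q) f = 0) : f = 0 := by
  classical
  set U : Fin n × Fin n → Fin n → ℝ := fun w i => if i = w.1 ∨ i = w.2 then (1 : ℝ) else 0 with hU
  set h : MvPolynomial (Fin n × Fin n) ℝ := aeval (fun e => ∑ w, C (dl (U w) e) * X w) f with hh
  have hev : ∀ t, eval t h = eval (fun e => ∑ w, t w * dl (U w) e) f := by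
    intro t
    rw [hh, eval_aeval]
    simp [mul_comm]
  have hhom : h.IsHomogeneous k := by
    have := IsHomogeneous.aeval (n := 1) hf (fun e => ∑ w, C (dl (U w) e) * X w) (fun e => by
      apply IsHomogeneous.sum
      intro w _
      exact (isHomogeneous_X _ _).C_mul _)
    rwa [one_mul] at this
  have h0 : h = 0 := by
    ext a
    rw [coeff_zero]
    by_contra hne
    have hdeg : a.degree = k := by
      rw [Finsupp.degree_eq_weight_one]
      exact hhom hne
    apply hne
    apply vlem h (Fintype.card κ)
    · intro s τ hs hτ
      obtain ⟨q, hq⟩ := sum_embed (κ := κ) s hs (fun w i => τ w * U w i)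
        (fun w hw => by funext i; simp [hτ w hw])
      rw [hev, ← H q]
      congr 2
      funext e
      rw [hq]
      simp [dl_smul]
    · refine le_trans ?_ (hdeg.le.trans hk)
      rw [Finsupp.degree, Finset.card_eq_sum_ones]
      exact Finset.sum_le_sum fun i hi => Nat.one_le_iff_ne_zero.2 (Finsupp.mem_support_iff.1 hi)
  apply MvPolynomial.funext
  intro m
  obtain ⟨t, ht⟩ := surj_dl m
  rw [map_zero, ← funext ht, ← hev, h0, map_zero]
end CIC
end

section
namespace CIC
open MvPolynomial

theorem deriv_prod {A ι : Type*} [DecidableEq ι] [CommRing A] [Algebra ℝ A] (D : Derivation ℝ A A) (s : Finset ι)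
    (f : ι → A) : D (∏ i ∈ s, f i) = ∑ i ∈ s, (∏ j ∈ s.erase i, f j) * D (f i) := by
  induction s using Finset.induction_on with
  | empty => simp
  | insert a s ha ih =>
    rw [Finset.prod_insert ha, Derivation.leibniz, ih, Finset.sum_insert ha, Finset.erase_insert ha]
    rw [add_comm, smul_eq_mul, smul_eq_mul, Finset.mul_sum]
    congr 1
    apply Finset.sum_congr rfl
    intro i hi
    have : i ≠ a := fun h => ha (h ▸ hi)
    rw [Finset.erase_insert_of_ne this.symm, Finset.prod_insert (fun h => ha (Finset.mem_of_mem_erase h))]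
    ring

theorem deriv_det {A ι : Type*} [DecidableEq ι] [Fintype ι] [CommRing A] [Algebra ℝ A]
    (D : Derivation ℝ A A) (M : Matrix ι ι A) :
    D M.det = ∑ i, ∑ k, M.adjugate i k * D (M k i) := by
  have h : ∀ i, ∑ k, M.adjugate i k * D (M k i) = (M.updateCol i (fun k => D (M k i))).det := by
    intro i
    rw [← Matrix.cramer_apply, Matrix.cramer_eq_adjugate_mulVec]
    rfl
  simp only [h]
  rw [Matrix.det_apply, map_sum]
  simp only [Matrix.det_apply]
  rw [Finset.sum_comm]
  apply Finset.sum_congr rfl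
  intro σ _
  rw [Units.smul_def, map_zsmul, deriv_prod, Finset.smul_sum]
  apply Finset.sum_congr rfl
  intro i _
  rw [Units.smul_def, ← Finset.prod_erase_mul _ _ (Finset.mem_univ i)]
  congr 2
  · apply Finset.prod_congr rfl
    intro j hj
    rw [Matrix.updateCol_ne (Finset.ne_of_mem_erase hj)]
  · rw [Matrix.updateCol_self]

def edge {n : ℕ} (a b : Fin n) (h : a ≠ b) : Edge n := ⟨s(a, b), by simpa using h⟩

theorem edge_comm {n : ℕ} (a b : Fin n) (h : a ≠ b) : edge a b h = edge b a h.symm :=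
  Subtype.ext Sym2.eq_swap

theorem edge_inj {n : ℕ} {a b c e : Fin n} {h : a ≠ b} {h' : c ≠ e} :
    edge a b h = edge c e h' ↔ (a = c ∧ b = e) ∨ (a = e ∧ b = c) := by
  rw [edge, edge, Subtype.mk.injEq]
  exact Sym2.eq_iff

theorem edge_ex {n : ℕ} (e : Edge n) : ∃ a b h, e = edge a b h := by
  obtain ⟨⟨a, b⟩, he⟩ := e
  exact ⟨a, b, by simpa using he, rfl⟩

theorem dl_edge {R : Type*} [CommRing R] {n : ℕ} (u : Fin n → R) (a b : Fin n) (h : a ≠ b) :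
    dl u (edge a b h) = (u a - u b) ^ 2 := rfl

def mm {R : Type*} [CommRing R] {n : ℕ} (m : Edge n → R) (a b : Fin n) : R :=
  if h : a = b then 0 else m (edge a b h)

theorem mm_self {R : Type*} [CommRing R] {n : ℕ} (m : Edge n → R) (a : Fin n) : mm m a a = 0 := by
  simp [mm]

theorem mm_ne {R : Type*} [CommRing R] {n : ℕ} (m : Edge n → R) (a b : Fin n) (h : a ≠ b) :
    mm m a b = m (edge a b h) := by
  simp [mm, h]

theorem mm_comm {R : Type*} [CommRing R] {n : ℕ} (m : Edge n → R) (a b : Fin n) :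
    mm m a b = mm m b a := by
  by_cases h : a = b
  · subst h; rfl
  · rw [mm_ne _ _ _ h, mm_ne _ _ _ (Ne.symm h), edge_comm]

def CMat {R : Type*} [CommRing R] {n : ℕ} (m : Edge n → R) :
    Matrix (Option (Fin n)) (Option (Fin n)) R := Matrix.of fun x y =>
  match x, y with
  | none, none => 0
  | none, some _ => 1
  | some _, none => 1
  | some a, some b => mm m a b

section
variable {R : Type*} [CommRing R] {n : ℕ} (m : Edge n → R)
theorem C00 : CMat m none none = 0 := rfl
theorem C01 (a) : CMat m none (some a) = 1 := rfl
theorem C10 (a) : CMat m (some a) none = 1 := rfl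
theorem C11 (a b) : CMat m (some a) (some b) = mm m a b := rfl
theorem CT : (CMat m).transpose = CMat m := by
  ext x y
  rcases x with _ | a <;> rcases y with _ | b <;> first | rfl | exact mm_comm _ _ _
theorem adj_comm (x y) : (CMat m).adjugate x y = (CMat m).adjugate y x := by
  conv_lhs => rw [← CT m, ← Matrix.adjugate_transpose]
  rfl
end

/-- Cayley-Menger polynomial -/
noncomputable def Pm (R : Type*) [CommRing R] (n : ℕ) : MvPolynomial (Edge n) R := (CMat X).det

theorem aeval_Pm {R A : Type*} [CommRing R] [CommRing A] [Algebra R A] {n : ℕ} (m : Edge n → A) :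
    aeval m (Pm R n) = (CMat m).det := by
  rw [Pm, AlgHom.map_det]
  congr 1
  ext x y
  rcases x with _ | a <;> rcases y with _ | b <;>
    simp [AlgHom.mapMatrix_apply, CMat, mm] 
  split_ifs <;> simp

theorem eval_Pm {n : ℕ} (m : Edge n → ℝ) : eval m (Pm ℝ n) = (CMat m).det := by
  rw [← aeval_eq_eval]
  exact aeval_Pm m

theorem Pm_hom (R : Type*) [CommRing R] (n : ℕ) (hn : 1 ≤ n) : (Pm R n).IsHomogeneous (n - 1) := by
  rw [Pm, Matrix.det_apply]
  apply IsHomogeneous.sum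
  intro σ _
  have key : (∏ i, CMat (X : Edge n → MvPolynomial (Edge n) R) (σ i) i).IsHomogeneous (n - 1) := by
    by_cases hσ : σ none = none
    · rw [Finset.prod_eq_zero (Finset.mem_univ none)]
      · exact isHomogeneous_zero _ _ _
      · rw [hσ]; rfl
    · have hd : ∑ x : Option (Fin n), (if x = none ∨ σ x = none then 0 else 1) = n - 1 := by
        have hne : σ.symm none ≠ none := by
          intro h
          apply hσ
          rw [Equiv.symm_apply_eq] at h
          exact h.symm
        have : (Finset.univ.filter fun x : Option (Fin n) => (x = none ∨ σ x = none)) =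
            {none, σ.symm none} := by
          ext x
          simp only [Finset.mem_filter, Finset.mem_univ, true_and, Finset.mem_insert,
            Finset.mem_singleton, Equiv.eq_symm_apply]
        have h3 : ∑ x : Option (Fin n), (if x = none ∨ σ x = none then 0 else 1)
            + ∑ x : Option (Fin n), (if x = none ∨ σ x = none then 1 else 0) = n + 1 := by
          rw [← Finset.sum_add_distrib, Finset.sum_congr rfl (g := fun _ => 1) (by
            intro x _; split_ifs <;> rfl)]
          simp
        rw [← Finset.card_filter, this, Finset.card_pair hne.symm] at h3
        omega
      rw [← hd]
      apply IsHomogeneous.prod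
      intro x _
      rcases x with _ | b
      · rw [if_pos (Or.inl rfl)]
        rcases hs : σ none with _ | a
        · exact absurd hs hσ
        · exact isHomogeneous_one _ _
      · rcases hs : σ (some b) with _ | a
        · rw [if_pos (Or.inr rfl)]
          exact isHomogeneous_one _ _
        · rw [if_neg (by simp), C11, mm]
          split_ifs
          · exact isHomogeneous_zero _ _ _
          · exact isHomogeneous_X _ _
  rw [Units.smul_def, ← Int.cast_smul_eq_zsmul R]
  rw [smul_eq_C_mul]
  exact key.C_mul _

theorem det_M {K κ : Type*} [Field K] [Fintype κ] {n : ℕ} (hn : Fintype.card κ + 1 < n)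
    (q : Fin n → κ → K) : (CMat (sqm q)).det = 0 := by
  classical
  by_contra hdet
  let U : Matrix (Option (Fin n)) (Option (Option κ)) K := Matrix.of fun x y =>
    match x, y with
    | none, none => 0
    | none, some none => 1
    | none, some (some _) => 0
    | some _, none => 1
    | some a, some none => ∑ k, q a k ^ 2
    | some a, some (some k) => q a k
  let W : Matrix (Option (Option κ)) (Option (Fin n)) K := Matrix.of fun y x =>
    match x, y with
    | none, none => 1
    | none, some none => 0
    | none, some (some _) => 0
    | some a, none => ∑ k, q a k ^ 2
    | some _, some none => 1
    | some a, some (some k) => -2 * q a k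
  have hUW : CMat (sqm q) = U * W := by
    ext x y
    rw [Matrix.mul_apply, Fintype.sum_option, Fintype.sum_option]
    rcases x with _ | a <;> rcases y with _ | b <;> simp [U, W, C00, C01, C10, C11]
    rw [← Finset.sum_neg_distrib, ← Finset.sum_add_distrib, ← Finset.sum_add_distrib]
    by_cases h : a = b
    · subst h
      rw [mm_self, eq_comm]
      exact Finset.sum_eq_zero fun k _ => by ring
    · rw [mm_ne _ _ _ h, sqm]
      apply Finset.sum_congr rfl
      intro k _
      rw [dl_edge]
      ring
  have h1 : (CMat (sqm q)).rank = Fintype.card (Option (Fin n)) :=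
    Matrix.rank_of_isUnit _ ((Matrix.isUnit_iff_isUnit_det _).2 (isUnit_iff_ne_zero.2 hdet))
  have h2 := (Matrix.rank_mul_le_left U W).trans (Matrix.rank_le_card_width U)
  rw [← hUW, h1] at h2
  simp at h2
  omega

theorem grad_Pm {n : ℕ} (m : Edge n → ℝ) (a b : Fin n) (h : a ≠ b) :
    eval m (pderiv (edge a b h) (Pm ℝ n)) = 2 * (CMat m).adjugate (some a) (some b) := by
  have key : pderiv (edge a b h) (Pm ℝ n) =
      2 * (CMat (X : Edge n → MvPolynomial (Edge n) ℝ)).adjugate (some a) (some b) := by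
    rw [Pm, deriv_det, Fintype.sum_option]
    have h0 : ∀ x, pderiv (edge a b h) (CMat (X : Edge n → MvPolynomial (Edge n) ℝ) none x) = 0 := by
      intro x
      rcases x with _ | x
      · simp [C00]
      · simp [C01]
    have h1 : ∀ x, pderiv (edge a b h) (CMat (X : Edge n → MvPolynomial (Edge n) ℝ) x none) = 0 := by
      intro x
      rcases x with _ | x
      · simp [C00]
      · simp [C10]
    have h2 : ∀ x y, pderiv (edge a b h) (CMat (X : Edge n → MvPolynomial (Edge n) ℝ) (some x) (some y))
        = if (x = a ∧ y = b) then 1 else if (x = b ∧ y = a) then 1 else 0 := by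
      intro x y
      rw [C11]
      by_cases hxy : x = y
      · subst hxy
        rw [mm_self, if_neg (fun hh => h (hh.1.symm.trans hh.2)),
          if_neg (fun hh => h (hh.2.symm.trans hh.1)), map_zero]
      · rw [mm_ne _ _ _ hxy, pderiv_X, Pi.single_apply]
        simp only [edge_inj]
        by_cases hc : x = a ∧ y = b
        · simp [hc]
        · by_cases hc' : x = b ∧ y = a
          · simp [hc']
          · simp [hc, hc']
    simp only [h1, mul_zero, Finset.sum_const_zero, zero_add, Fintype.sum_option, h0]
    rw [Finset.sum_eq_add a b h]
    · rw [Finset.sum_eq_single b, Finset.sum_eq_single a]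
      · rw [h2, h2]
        simp only [and_self, if_true, h, h.symm, if_false]
        rw [adj_comm _ (some b)]; ring
      · intro y _ hy
        rw [h2, if_neg (by tauto), if_neg (by tauto), mul_zero]
      · simp
      · intro y _ hy
        rw [h2, if_neg (by tauto), if_neg (by tauto), mul_zero]
      · simp
    · intro c _ hc
      apply Finset.sum_eq_zero
      intro y _
      rw [h2, if_neg (by tauto), if_neg (by tauto), mul_zero]
    · simp
    · simp
  rw [key, map_mul]
  have e1 : eval m (2 : MvPolynomial (Edge n) ℝ) = 2 := by simp
  rw [e1]
  congr 1
  have := congrFun (congrFun (RingHom.map_adjugate (eval m) (CMat X)) (some a)) (some b)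
  rw [RingHom.mapMatrix_apply, Matrix.map_apply] at this
  rw [this]
  have hC : (eval m).mapMatrix (CMat X) = CMat m := ?_
  · rw [hC]
  ext x y
  rcases x with _ | a <;> rcases y with _ | b <;>
    simp [RingHom.mapMatrix_apply, CMat, mm] 
  split_ifs <;> simp

/-- the degenerate locus -/
def Lam {n : ℕ} (i j : Fin n) (m : Edge n → ℝ) : Prop :=
  mm m i j = 0 ∧ ∀ k, mm m i k = mm m j k

theorem row_eq {n : ℕ} {i j : Fin n} {m : Edge n → ℝ} (h : Lam i j m) :
    CMat m (some i) = CMat m (some j) := by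
  funext x
  rcases x with _ | x
  · rfl
  · exact h.2 x

theorem Lam_det {n : ℕ} {i j : Fin n} (hij : i ≠ j) {m : Edge n → ℝ} (h : Lam i j m) :
    (CMat m).det = 0 :=
  Matrix.det_zero_of_row_eq (i := some i) (j := some j) (by simpa using hij) (row_eq h)

theorem Lam_grad {n : ℕ} {i j : Fin n} (hij : i ≠ j) {m : Edge n → ℝ} (h : Lam i j m) (e : Edge n)
    (he : e ≠ edge i j hij) : eval m (pderiv e (Pm ℝ n)) = 0 := by
  obtain ⟨a, b, hab, rfl⟩ := edge_ex e
  rw [grad_Pm]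
  have key : ∀ a b : Fin n, b ≠ i → b ≠ j → (CMat m).adjugate (some a) (some b) = 0 := by
    intro a b hi hj
    rw [Matrix.adjugate_apply]
    apply Matrix.det_zero_of_row_eq (i := some i) (j := some j) (by simpa using hij)
    rw [Matrix.updateRow_ne (by simpa using hi.symm), Matrix.updateRow_ne (by simpa using hj.symm)]
    exact row_eq h
  by_cases hb : b ≠ i ∧ b ≠ j
  · rw [key a b hb.1 hb.2, mul_zero]
  · rw [adj_comm, key b a, mul_zero]
    · rintro rfl
      apply he
      rw [edge_inj]
      tauto
    · rintro rfl
      apply he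
      rw [edge_inj]
      tauto

/-- the point `1 - δ_e` -/
noncomputable def me {n : ℕ} (e : Edge n) : Edge n → ℝ := fun f => if f = e then 0 else 1

theorem me_Lam {n : ℕ} (i j : Fin n) (hij : i ≠ j) : Lam i j (me (edge i j hij)) := by
  refine ⟨by rw [mm_ne _ _ _ hij]; simp [me], fun k => ?_⟩
  by_cases h1 : i = k
  · subst h1
    rw [mm_self, mm_ne _ _ _ hij.symm, edge_comm]; simp [me]
  · by_cases h2 : j = k
    · subst h2
      rw [mm_self, mm_ne _ _ _ hij]; simp [me]
    · rw [mm_ne _ _ _ h1, mm_ne _ _ _ h2, me, me, if_neg, if_neg]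
      · rw [edge_inj]; tauto
      · rw [edge_inj]; tauto

theorem me_grad_ne {n : ℕ} (e f : Edge n) (h : f ≠ e) : eval (me e) (pderiv f (Pm ℝ n)) = 0 := by
  obtain ⟨i, j, hij, rfl⟩ := edge_ex e
  exact Lam_grad hij (me_Lam i j hij) f h

theorem me_grad {n : ℕ} (e : Edge n) : eval (me e) (pderiv e (Pm ℝ n)) ≠ 0 := by
  obtain ⟨i, j, hij, rfl⟩ := edge_ex e
  rw [grad_Pm, Matrix.adjugate_apply]
  apply mul_ne_zero two_ne_zero
  intro h0
  obtain ⟨v, hv, hv0⟩ := Matrix.exists_mulVec_eq_zero_iff.2 h0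
  set m := me (edge i j hij)
  have hi : v (some i) = 0 := by
    have := congrFun hv0 (some j)
    rw [Matrix.mulVec, Matrix.updateRow_self, single_one_dotProduct] at this
    exact this
  have hrow : ∀ x, x ≠ some j → ∑ y, CMat m x y * v y = 0 := by
    intro x hx
    have := congrFun hv0 x
    simpa [Matrix.mulVec, dotProduct, Matrix.updateRow_ne hx] using this
  have hs := hrow none (by simp)
  rw [Fintype.sum_option] at hs
  simp only [C00, C01, zero_mul, one_mul, zero_add] at hs
  have ha : ∀ a, a ≠ j → a ≠ i → v (some a) = v none := by
    intro a hj hi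
    have := hrow (some a) (by simpa using hj)
    rw [Fintype.sum_option] at this
    simp only [C10, C11, one_mul] at this
    have e2 : ∑ b, mm m a b * v (some b) = ∑ b, v (some b) - v (some a) := by
      rw [← Finset.sum_erase_add _ _ (Finset.mem_univ a), ← Finset.sum_erase_add (a := a) _ _ (Finset.mem_univ a),
        mm_self, zero_mul, add_zero, add_sub_cancel_right]
      apply Finset.sum_congr rfl
      intro b hb
      have hb : a ≠ b := (Finset.ne_of_mem_erase hb).symm
      rw [mm_ne _ _ _ hb]
      simp only [m, me]
      rw [if_neg, one_mul]
      rw [edge_inj]; tauto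
    rw [e2, hs] at this
    linarith
  have hj : v (some j) = v none := by
    have := hrow (some i) (by simpa using hij)
    rw [Fintype.sum_option] at this
    simp only [C10, C11, one_mul] at this
    have e2 : ∑ b, mm m i b * v (some b) = ∑ b, v (some b) - v (some j) := by
      rw [← Finset.sum_erase_add _ _ (Finset.mem_univ j), ← Finset.sum_erase_add (a := j) _ _ (Finset.mem_univ j),
        add_sub_cancel_right, mm_ne _ _ _ hij]
      rw [show m (edge i j hij) = 0 by simp [m, me], zero_mul, add_zero]
      apply Finset.sum_congr rfl
      intro b hb
      have hb : b ≠ j := (Finset.ne_of_mem_erase hb)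
      by_cases hib : i = b
      · subst hib; rw [hi, mul_zero]
      · rw [mm_ne _ _ _ hib]
        simp only [m, me]
        rw [if_neg, one_mul]
        rw [edge_inj]; tauto
    rw [e2, hs] at this
    linarith
  have hall : ∀ a, a ≠ i → v (some a) = v none := by
    intro a hai
    by_cases haj : a = j
    · rw [haj, hj]
    · exact ha a haj hai
  have hv0' : v none = 0 := by
    rw [← Finset.sum_erase_add _ _ (Finset.mem_univ i), hi, add_zero] at hs
    rw [Finset.sum_congr rfl (g := fun _ => v none) (fun a h => hall a (Finset.ne_of_mem_erase h))] at hs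
    rw [Finset.sum_const, smul_eq_zero] at hs
    rcases hs with hs | hs
    · rw [Finset.card_eq_zero] at hs
      have : j ∈ Finset.univ.erase i := by simp [hij.symm]
      rw [hs] at this
      simp at this
    · exact hs
  apply hv
  funext x
  rcases x with _ | a
  · exact hv0'
  · by_cases h : a = i
    · rw [h, hi]; rfl
    · rw [hall a h, hv0']; rfl

theorem grad_single {n : ℕ} (m : Edge n → ℝ) (hdet : (CMat m).det = 0) (a b : Fin n) (hab : a ≠ b)
    (h1 : eval m (pderiv (edge a b hab) (Pm ℝ n)) ≠ 0)
    (h2 : ∀ f, f ≠ edge a b hab → eval m (pderiv f (Pm ℝ n)) = 0) : Lam a b m := by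
  rw [grad_Pm] at h1
  have hx : (CMat m).adjugate (some a) (some b) ≠ 0 := fun h => h1 (by rw [h, mul_zero])
  set x := (CMat m).adjugate (some b) (some a) with hxdef
  have hx' : x ≠ 0 := by rwa [hxdef, adj_comm]
  have h0 : ∀ c, c ≠ a → c ≠ b → (CMat m).adjugate (some c) (some a) = 0 := by
    intro c hca hcb
    have := h2 (edge c a hca) (by rw [Ne, edge_inj]; tauto)
    rw [grad_Pm] at this
    linarith
  have hmul : ∀ r, ∑ y, CMat m r y * (CMat m).adjugate y (some a) = 0 := by
    intro r
    have := congrFun (congrFun (Matrix.mul_adjugate (CMat m)) r) (some a)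
    rw [hdet, zero_smul] at this
    simpa [Matrix.mul_apply] using this
  have hsum : ∀ g : Fin n → ℝ, ∑ c, g c * (CMat m).adjugate (some c) (some a) =
      g a * (CMat m).adjugate (some a) (some a) + g b * x := by
    intro g
    rw [Finset.sum_eq_add a b hab]
    · intro c _ hc
      rw [h0 c hc.1 hc.2, mul_zero]
    · simp
    · simp
  have hn := hmul none
  rw [Fintype.sum_option] at hn
  simp only [C00, C01, zero_mul, zero_add] at hn
  rw [hsum (fun _ => 1)] at hn
  have hr : ∀ c, (CMat m).adjugate none (some a) + (mm m c a * (CMat m).adjugate (some a) (some a) + mm m c b * x) = 0 := by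
    intro c
    have := hmul (some c)
    rw [Fintype.sum_option] at this
    simp only [C10, C11, one_mul] at this
    rwa [hsum (fun d => mm m c d)] at this
  have haa : (CMat m).adjugate (some a) (some a) = -x := by linarith
  rw [haa] at hr
  have ra := hr a
  have rb := hr b
  rw [mm_self] at ra rb
  rw [mm_comm m b a] at rb
  have hm : mm m a b = 0 := by
    have : mm m a b * x = 0 := by linarith
    exact (mul_eq_zero.1 this).resolve_right hx'
  rw [hm] at ra
  refine ⟨hm, fun k => ?_⟩
  have := hr k
  rw [mm_comm m a, mm_comm m b]
  have : (mm m k b - mm m k a) * x = 0 := by linarith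
  have := (mul_eq_zero.1 this).resolve_right hx'
  linarith
end CIC
end

section
namespace CIC
open MvPolynomial

theorem scale_prod {d n : ℕ} (f : MvPolynomial (Edge n) ℝ) (hf : f.IsHomogeneous (d + 1))
    (H : ∀ q : Fin n → Fin d → ℝ, eval (sqm q) f = 0) (u : Fin (d + 1) → Fin n → ℝ)
    (t : Fin (d + 1) → ℝ) :
    eval (fun e => ∑ k, t k * dl (u k) e) f = (∏ k, t k) * eval (fun e => ∑ k, dl (u k) e) f := by
  classical
  set h : MvPolynomial (Fin (d + 1)) ℝ := aeval (fun e => ∑ w, C (dl (u w) e) * X w) f with hh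
  have hev : ∀ t, eval t h = eval (fun e => ∑ w, t w * dl (u w) e) f := by
    intro t
    rw [hh, eval_aeval]
    simp [mul_comm]
  have hhom : h.IsHomogeneous (d + 1) := by
    have := IsHomogeneous.aeval (n := 1) hf (fun e => ∑ w, C (dl (u w) e) * X w) (fun e => by
      apply IsHomogeneous.sum
      intro w _
      exact (isHomogeneous_X _ _).C_mul _)
    rwa [one_mul] at this
  set a1 : Fin (d + 1) →₀ ℕ := Finsupp.equivFunOnFinite.symm (fun _ => 1) with ha1
  have h0 : h = monomial a1 (coeff a1 h) := by
    ext a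
    rw [coeff_monomial]
    split_ifs with ha
    · rw [ha]
    · by_contra hne
      have hdeg : a.degree = d + 1 := by
        rw [Finsupp.degree_eq_weight_one]
        exact hhom hne
      have hcard : ¬ a.support.card ≤ d := by
        intro hc
        apply hne
        apply vlem h d _ a hc
        intro s τ hs hτ
        obtain ⟨q, hq⟩ := sum_embed (κ := Fin d) s (by simpa using hs) (fun w i => τ w * u w i)
          (fun w hw => by funext i; simp [hτ w hw])
        rw [hev, ← H q]
        congr 2
        funext e
        rw [hq]
        simp [dl_smul]
      have hs : a.support = Finset.univ := by
        apply Finset.eq_univ_of_card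
        have := Finset.card_le_univ a.support
        simp only [Fintype.card_fin] at this ⊢
        omega
      have hpos : ∀ i, 1 ≤ a i := fun i => Nat.one_le_iff_ne_zero.2
        (Finsupp.mem_support_iff.1 (hs ▸ Finset.mem_univ i))
      rw [Finsupp.degree_eq_sum] at hdeg
      have heq : ∀ i ∈ Finset.univ, 1 = a i := by
        apply (Finset.sum_eq_sum_iff_of_le (fun i _ => hpos i)).1
        rw [hdeg]; simp
      apply ha
      ext i
      rw [ha1, ← heq i (Finset.mem_univ i)]
      rfl
  have hc : ∀ t, eval t h = coeff a1 h * ∏ k, t k := by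
    intro t
    rw [h0, eval_monomial, coeff_monomial, if_pos rfl, Finsupp.prod_fintype]
    · simp [ha1]
    · simp
  have e1 := hc 1
  rw [hev] at e1
  simp only [Pi.one_apply, one_mul, Finset.prod_const_one, mul_one] at e1
  rw [← hev, hc, e1, mul_comm]

theorem dl_gram {κ : Type*} [Fintype κ] {n : ℕ} (l : κ → ℝ) (u : κ → Fin n → ℝ) (a b : Fin n) (h : a ≠ b) :
    ∑ k, l k * dl (u k) (edge a b h) = ∑ k, l k * u k a * u k a + ∑ k, l k * u k b * u k b
      - 2 * ∑ k, l k * u k a * u k b := by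
  rw [Finset.mul_sum, ← Finset.sum_add_distrib, ← Finset.sum_sub_distrib]
  apply Finset.sum_congr rfl
  intro k _
  rw [dl_edge]; ring

theorem ulem_aux (d : ℕ) : ∃ ms : Edge (d + 2) → ℝ, ∀ q : Fin (d + 2) → Fin (d + 1) → ℝ, ∃ c : ℝ,
    ∀ f : MvPolynomial (Edge (d + 2)) ℝ, f.IsHomogeneous (d + 1) →
    (∀ q : Fin (d + 2) → Fin d → ℝ, eval (sqm q) f = 0) → eval (sqm q) f = c * eval ms f := by
  classical
  refine ⟨fun e => ∑ k : Fin (d + 1), dl (Fin.cons 0 (fun i => if i = k then 1 else 0)) e, fun q => ?_⟩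
  set A : Matrix (Fin (d + 1)) (Fin (d + 1)) ℝ := Matrix.of fun i k => q i.succ k - q 0 k with hA
  have hX : (A * A.transpose).IsHermitian := by
    have := Matrix.isHermitian_mul_conjTranspose_self A
    rwa [Matrix.conjTranspose_eq_transpose_of_trivial] at this
  set O : Matrix (Fin (d + 1)) (Fin (d + 1)) ℝ := hX.eigenvectorUnitary.1 with hO
  set l := hX.eigenvalues with hl
  have hsp : A * A.transpose = O * Matrix.diagonal l * O.transpose := by
    have := hX.spectral_theorem
    rw [Unitary.conjStarAlgAut_apply, Matrix.star_eq_conjTranspose, Matrix.conjTranspose_eq_transpose_of_trivial] at this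
    exact this
  have hor : O * O.transpose = 1 := by
    have := Unitary.mul_star_self_of_mem hX.eigenvectorUnitary.2
    rwa [Matrix.star_eq_conjTranspose, Matrix.conjTranspose_eq_transpose_of_trivial] at this
  set u : Fin (d + 1) → Fin (d + 2) → ℝ := fun k => Fin.cons 0 (fun i => O i k) with hu
  have g1 : ∀ a b, ∑ k, l k * u k a * u k b = ∑ k, (q a k - q 0 k) * (q b k - q 0 k) := by
    intro a b
    refine Fin.cases ?_ (fun a => ?_) a
    · simp [hu]
    · refine Fin.cases ?_ (fun b => ?_) b
      · simp [hu]
      · have := congrFun (congrFun hsp a) b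
        rw [Matrix.mul_apply, Matrix.mul_apply] at this
        simp only [Matrix.mul_diagonal, Matrix.transpose_apply, hA, Matrix.of_apply] at this
        rw [this]
        apply Finset.sum_congr rfl
        intro k _
        simp only [hu, Fin.cons_succ]; ring
  have g2 : ∀ a b, ∑ k, u k a * u k b = ∑ k : Fin (d + 1),
      (Fin.cons 0 (fun i => if i = k then (1:ℝ) else 0) : Fin (d + 2) → ℝ) a *
      (Fin.cons 0 (fun i => if i = k then (1:ℝ) else 0) : Fin (d + 2) → ℝ) b := by
    intro a b
    refine Fin.cases ?_ (fun a => ?_) a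
    · simp [hu]
    · refine Fin.cases ?_ (fun b => ?_) b
      · simp [hu]
      · have := congrFun (congrFun hor a) b
        rw [Matrix.mul_apply, Matrix.one_apply] at this
        simp only [Matrix.transpose_apply] at this
        simp only [hu, Fin.cons_succ, this]
        simp
  have m1 : sqm q = fun e => ∑ k, l k * dl (u k) e := by
    funext e
    obtain ⟨a, b, hab, rfl⟩ := edge_ex e
    rw [dl_gram, g1, g1, g1, sqm, Finset.mul_sum, ← Finset.sum_add_distrib, ← Finset.sum_sub_distrib]
    apply Finset.sum_congr rfl
    intro k _
    rw [dl_edge]; ring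
  have m2 : (fun e => ∑ k : Fin (d + 1), dl (Fin.cons 0 (fun i => if i = k then (1:ℝ) else 0)) e) =
      fun e => ∑ k, dl (u k) e := by
    funext e
    obtain ⟨a, b, hab, rfl⟩ := edge_ex e
    have e1 := dl_gram (fun _ => 1) u a b hab
    have e2 := dl_gram (κ := Fin (d + 1)) (fun _ => 1) (fun k => Fin.cons 0 (fun i => if i = k then (1:ℝ) else 0)) a b hab
    simp only [one_mul, g2] at e1 e2
    rw [e1, e2]
  refine ⟨∏ k, l k, fun f hf H => ?_⟩
  rw [m1, m2, scale_prod f hf H]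

theorem Pm_ne {n : ℕ} (hn : 2 ≤ n) : Pm ℝ n ≠ 0 := by
  intro h
  have := me_grad (edge (⟨0, by omega⟩ : Fin n) ⟨1, by omega⟩ (by simp))
  rw [h] at this
  simp at this

theorem ulem {d : ℕ} (f : MvPolynomial (Edge (d + 2)) ℝ) (hf : f.IsHomogeneous (d + 1))
    (H : ∀ q : Fin (d + 2) → Fin d → ℝ, eval (sqm q) f = 0) : ∃ κ : ℝ, f = C κ * Pm ℝ (d + 2) := by
  obtain ⟨ms, hms⟩ := ulem_aux d
  have hP : (Pm ℝ (d + 2)).IsHomogeneous (d + 1) := Pm_hom ℝ (d + 2) (by omega)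
  have hP0 : ∀ q : Fin (d + 2) → Fin d → ℝ, eval (sqm q) (Pm ℝ (d + 2)) = 0 := by
    intro q
    rw [eval_Pm]
    exact det_M (by simp) q
  have hne : eval ms (Pm ℝ (d + 2)) ≠ 0 := by
    intro h0
    apply Pm_ne (n := d + 2) (by omega)
    apply dgl (κ := Fin (d + 1)) _ hP (by simp)
    intro q
    obtain ⟨c, hc⟩ := hms q
    rw [hc _ hP hP0, h0, mul_zero]
  refine ⟨eval ms f / eval ms (Pm ℝ (d + 2)), ?_⟩
  rw [← sub_eq_zero]
  apply dgl (κ := Fin (d + 1)) _ (hf.sub (hP.C_mul _)) (by simp)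
  intro q
  obtain ⟨c, hc⟩ := hms q
  rw [map_sub, map_mul, eval_C, hc _ hf H, hc _ hP hP0]
  field_simp
  ring
end CIC
end

section
namespace CIC
open MvPolynomial

noncomputable def Pex (n : ℕ) : MvPolynomial (Edge n) ℝ := expand 2 (Pm ℝ n)
noncomputable def PP {n : ℕ} (y : Edge n → ℝ) : ℝ := eval (fun i => y i ^ 2) (Pm ℝ n)
noncomputable def De {n : ℕ} (e : Edge n) (y : Edge n → ℝ) : ℝ :=
  eval (fun i => y i ^ 2) (pderiv e (Pm ℝ n))

theorem eval_Pex {n : ℕ} (y : Edge n → ℝ) : eval y (Pex n) = PP y := eval_expand _ _ _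

theorem pderiv_Pex {n : ℕ} (e : Edge n) (y : Edge n → ℝ) :
    eval y (pderiv e (Pex n)) = 2 * y e * De e y := by
  have h : Pex n = aeval (fun i => X i ^ 2) (Pm ℝ n) := rfl
  rw [h, chain, map_sum, Finset.sum_eq_single e]
  · rw [map_mul, eval_aeval]
    simp [De]
    ring
  · intro b _ hb
    rw [pderiv_pow, pderiv_X_of_ne hb]
    simp
  · simp

def flip {n : ℕ} (e : Edge n) (y : Edge n → ℝ) : Edge n → ℝ := fun i => if i = e then - y i else y i

theorem flip_sq {n : ℕ} (e : Edge n) (y : Edge n → ℝ) : (fun i => flip e y i ^ 2) = fun i => y i ^ 2 := by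
  funext i
  rw [flip]; split_ifs <;> ring

theorem PP_flip {n : ℕ} (e : Edge n) (y : Edge n → ℝ) : PP (flip e y) = PP y := by
  rw [PP, flip_sq]; rfl

theorem De_flip {n : ℕ} (f e : Edge n) (y : Edge n → ℝ) : De f (flip e y) = De f y := by
  rw [De, flip_sq]; rfl

theorem flip_ne {n : ℕ} (e : Edge n) (y : Edge n → ℝ) (h : ∀ i, y i ≠ 0) : ∀ i, flip e y i ≠ 0 := by
  intro i
  rw [flip]; split_ifs
  · exact neg_ne_zero.2 (h i)
  · exact h i

theorem De_indep {n : ℕ} (α : Edge n → ℝ)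
    (h : ∀ y : Edge n → ℝ, (∀ i, y i ≠ 0) → ∑ e, α e * De e y = 0) : ∀ e, α e = 0 := by
  intro e
  have h0 : ∑ e, C (α e) * pderiv e (Pm ℝ n) = 0 := by
    apply zero_of_sq
    intro y hy
    rw [map_sum, ← h y hy]
    simp [De]
  have := congrArg (eval (me e)) h0
  rw [map_sum, map_zero, Finset.sum_eq_single e] at this
  · rw [map_mul, eval_C] at this
    exact (mul_eq_zero.1 this).resolve_right (me_grad e)
  · intro b _ hb
    rw [map_mul, me_grad_ne _ _ hb, mul_zero]
  · simp

theorem sep {n : ℕ} (g : Edge n → (Edge n → ℝ) → ℝ) (hg : ∀ i e y, g i (flip e y) = g i y)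
    (h : ∀ y : Edge n → ℝ, (∀ i, y i ≠ 0) → ∑ i, y i * g i y = 0) (e : Edge n) (y : Edge n → ℝ)
    (hy : ∀ i, y i ≠ 0) : g e y = 0 := by
  have h1 := h y hy
  have h2 := h (flip e y) (flip_ne e y hy)
  have h3 : ∑ i, (y i * g i y - flip e y i * g i (flip e y)) = 0 := by
    rw [Finset.sum_sub_distrib, h1, h2, sub_zero]
  rw [Finset.sum_eq_single e] at h3
  · rw [hg] at h3
    simp only [flip, if_true] at h3
    have : y e * g e y = 0 := by linarith
    exact (mul_eq_zero.1 this).resolve_left (hy e)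
  · intro i _ hi
    rw [hg]
    simp [flip, hi]
  · simp

theorem lineal {n : ℕ} (v : Edge n → ℝ)
    (h : ∀ y : Edge n → ℝ, (∀ i, y i ≠ 0) → ∑ i, v i * (2 * y i * De i y) = 0) : ∀ e, v e = 0 := by
  intro e
  have h1 := sep (fun i y => v i * De i y) (fun i e y => by simp only [De_flip]) (fun y hy => by
    rw [← mul_right_inj' (two_ne_zero (α := ℝ)), mul_zero, ← h y hy, Finset.mul_sum]
    exact Finset.sum_congr rfl fun i _ => by ring)
  have := De_indep (fun i => if i = e then v i else 0) (fun y hy => by simpa using h1 e y hy) e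
  simpa using this

theorem poly_zero_of_nat (p : Polynomial ℝ) (g : ℕ → ℝ) (hg : Function.Injective g)
    (h : ∀ k, p.eval (g k) = 0) : p = 0 := by
  apply Polynomial.eq_zero_of_infinite_isRoot
  exact (Set.infinite_range_of_injective hg).mono (by rintro _ ⟨k, rfl⟩; exact h k)

theorem line_const_nat {σ : Type*} [Fintype σ] (f : MvPolynomial σ ℝ) (y v : σ → ℝ) (c : ℝ)
    (h : ∀ t : ℕ, eval (fun i => y i + t * v i) f = c) :
    ∑ i, v i * eval y (pderiv i f) = 0 := by
  apply line_const f y v c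
  have h1 : aeval (fun i => Polynomial.C (y i) + Polynomial.X * Polynomial.C (v i)) f
      - Polynomial.C c = 0 := by
    apply poly_zero_of_nat _ (fun k : ℕ => (k : ℝ)) Nat.cast_injective
    intro k
    rw [Polynomial.eval_sub, eval_poly]
    have := h k
    simp only [mul_comm (k : ℝ)] at this
    simp [this]
  intro t
  have := congrArg (Polynomial.eval t) h1
  rw [Polynomial.eval_sub, eval_poly] at this
  simp only [mul_comm t]
  simp at this
  linarith

theorem hom_eval {σ : Type*} [Fintype σ] {f : MvPolynomial σ ℝ} {k : ℕ} (hf : f.IsHomogeneous k)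
    (c : ℝ) (y : σ → ℝ) : eval (fun i => c * y i) f = c ^ k * eval y f := by
  rw [eval_eq', eval_eq', Finset.mul_sum]
  apply Finset.sum_congr rfl
  intro a ha
  have hdeg : a.degree = k := by
    rw [Finsupp.degree_eq_weight_one]
    exact hf (mem_support_iff.1 ha)
  rw [Finsupp.degree_eq_sum] at hdeg
  simp only [mul_pow, Finset.prod_mul_distrib, Finset.prod_pow_eq_pow_sum, hdeg]
  ring

theorem PP_smul {n : ℕ} (hn : 1 ≤ n) (κ : ℝ) (y : Edge n → ℝ) :
    PP (fun i => κ * y i) = κ ^ (2 * (n - 1)) * PP y := by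
  rw [PP, PP]
  simp only [mul_pow]
  rw [hom_eval (Pm_hom ℝ n hn), pow_mul]

theorem dih_zero {n : ℕ} (c φ : Edge n → ℝ) (h1 : ∑ i, φ i * c i = 1)
    (hinv : ∀ y, PP (fun i => y i - 2 * (∑ j, φ j * y j) * c i) = PP y) (e : Edge n)
    (hce : c e = 0) (hφ : φ e ≠ 0) : False := by
  have hφf : ∀ y, ∑ j, φ j * flip e y j = ∑ j, φ j * y j - 2 * φ e * y e := by
    intro y
    have : ∑ j, (φ j * y j - φ j * flip e y j) = 2 * φ e * y e := by
      rw [Finset.sum_eq_single e]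
      · simp [flip]; ring
      · intro i _ hi
        simp [flip, hi]
      · simp
    rw [Finset.sum_sub_distrib] at this
    linarith
  have hφl : ∀ (y : Edge n → ℝ) (s : ℝ), ∑ j, φ j * (y j + s * c j) = ∑ j, φ j * y j + s := by
    intro y s
    calc ∑ j, φ j * (y j + s * c j) = ∑ j, (φ j * y j + s * (φ j * c j)) :=
          Finset.sum_congr rfl fun _ _ => by ring
      _ = _ := by rw [Finset.sum_add_distrib, ← Finset.mul_sum, h1, mul_one]
  have hfc : ∀ (y : Edge n → ℝ) (s : ℝ), flip e (fun i => flip e y i + s * c i) = fun i => y i + s * c i := by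
    intro y s
    funext i
    simp only [flip]
    split_ifs with h
    · rw [h, hce]; ring
    · ring
  have step : ∀ y, PP (fun i => y i + (-4 * φ e * y e) * c i) = PP y := by
    intro y
    have e1 := hinv (flip e y)
    rw [hφf, PP_flip, ← PP_flip e] at e1
    have e2 : (fun i => flip e y i - 2 * (∑ j, φ j * y j - 2 * φ e * y e) * c i) =
        fun i => flip e y i + (-2 * (∑ j, φ j * y j - 2 * φ e * y e)) * c i := by
      funext i; ring
    rw [e2, hfc, ← hinv, hφl] at e1
    rw [← e1]
    congr 1
    funext i
    ring
  have it : ∀ (y : Edge n → ℝ) (k : ℕ), PP (fun i => y i + k * ((-4 * φ e * y e) * c i)) = PP y := by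
    intro y k
    induction k with
    | zero => simp
    | succ k ih =>
      rw [← ih, ← step (fun i => y i + k * ((-4 * φ e * y e) * c i))]
      congr 1
      funext i
      simp only [hce]
      push_cast
      ring
  have hc0 : ∀ i, c i = 0 := by
    apply lineal
    intro y hy
    have := line_const_nat (Pex n) y (fun i => (-4 * φ e * y e) * c i) (PP y) (fun k => by
      rw [eval_Pex]; exact it y k)
    simp only [pderiv_Pex, mul_assoc (-4 * φ e * y e), ← Finset.mul_sum] at this
    refine (mul_eq_zero.1 this).resolve_left ?_
    exact mul_ne_zero (mul_ne_zero (by norm_num) hφ) (hy e)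
  simp [hc0] at h1

theorem dih_core {n : ℕ} (hn : 1 ≤ n) (y0 a b : Edge n → ℝ) (μ μ' : ℝ) (hμ : μ * μ' = 1) (hμ' : μ' < -1)
    (H : ∀ u v, PP (fun i => y0 i + u * a i + v * b i) = PP (fun i => y0 i + μ * u * a i + μ' * v * b i))
    (u v : ℝ) : ∑ i, (v * b i - u * a i) * eval (fun i => y0 i + u * a i + v * b i) (pderiv i (Pex n)) = 0 := by
  set M := 2 * (n - 1)
  set y : Edge n → ℝ := fun i => y0 i + u * a i + v * b i with hy
  have it : ∀ k : ℕ, PP y = PP (fun i => y0 i + μ ^ k * u * a i + μ' ^ k * v * b i) := by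
    intro k
    induction k with
    | zero => simp [hy]
    | succ k ih =>
      rw [ih, H]
      congr 1
      funext i
      ring
  have it2 : ∀ k : ℕ, PP (fun i => μ' ^ k * y0 i + u * a i + (μ' ^ k) ^ 2 * v * b i) = (μ' ^ k) ^ M * PP y := by
    intro k
    rw [it k, ← PP_smul hn]
    congr 1
    funext i
    have : μ ^ k * μ' ^ k = 1 := by rw [← mul_pow, hμ, one_pow]
    linear_combination (- u * a i) * this
  have p1 : aeval (fun i => Polynomial.X * Polynomial.C (y0 i) + Polynomial.C (u * a i)
      + Polynomial.X ^ 2 * Polynomial.C (v * b i)) (Pex n) - Polynomial.X ^ M * Polynomial.C (PP y) = 0 := by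
    apply poly_zero_of_nat _ (fun k : ℕ => μ' ^ k)
    · intro k l hkl
      have : |μ'| ^ k = |μ'| ^ l := by
        rw [← abs_pow, ← abs_pow]; exact congrArg _ hkl
      apply pow_right_injective₀ (a := |μ'|) _ _ this
      · rw [abs_of_neg (by linarith)]; linarith
      · rw [abs_of_neg (by linarith)]; linarith
    · intro k
      rw [Polynomial.eval_sub, eval_poly, eval_Pex]
      simp only [Polynomial.eval_add, Polynomial.eval_mul, Polynomial.eval_X, Polynomial.eval_C, Polynomial.eval_pow]
      rw [← it2 k, sub_eq_zero]
      congr 1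
      funext i
      ring
  have p2 : aeval (fun i => Polynomial.X * Polynomial.C (y i)) (Pex n) = Polynomial.X ^ M * Polynomial.C (PP y) := by
    apply Polynomial.funext
    intro t
    rw [eval_poly, eval_Pex]
    simp only [Polynomial.eval_mul, Polynomial.eval_X, Polynomial.eval_C, Polynomial.eval_pow]
    rw [PP_smul hn]
  rw [sub_eq_zero, ← p2] at p1
  have p3 := congrArg (fun p => (Polynomial.derivative p).eval 1) p1
  simp only [poly_deriv] at p3
  rw [← sub_eq_zero, ← Finset.sum_sub_distrib] at p3
  rw [← p3]
  apply Finset.sum_congr rfl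
  intro i _
  have e1 : (fun i => Polynomial.eval 1 (Polynomial.X * Polynomial.C (y0 i) + Polynomial.C (u * a i)
      + Polynomial.X ^ 2 * Polynomial.C (v * b i))) = y := by
    funext i; simp [hy]
  have e2 : (fun i => Polynomial.eval 1 (Polynomial.X * Polynomial.C (y i))) = y := by
    funext i; simp
  rw [e1, e2]
  simp only [Polynomial.derivative_add, Polynomial.derivative_mul, Polynomial.derivative_X, Polynomial.derivative_C,
    Polynomial.derivative_X_pow, Polynomial.eval_add, Polynomial.eval_mul, Polynomial.eval_X, Polynomial.eval_C,
    Polynomial.eval_pow, Polynomial.eval_one, Polynomial.eval_zero]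
  simp [hy]
  ring

theorem dih {n : ℕ} (hn : 1 ≤ n) (c φ : Edge n → ℝ) (hc : ∀ i, 0 ≤ c i) (h1 : ∑ i, φ i * c i = 1)
    (hinv : ∀ y, PP (fun i => y i - 2 * (∑ j, φ j * y j) * c i) = PP y) (e : Edge n) : 0 ≤ φ e := by
  by_contra hneg
  push Not at hneg
  have hce : 0 < c e := by
    rcases (hc e).lt_or_eq with h | h
    · exact h
    · exact (dih_zero c φ h1 hinv e h.symm hneg.ne).elim
  obtain ⟨X, hX, hX2⟩ : ∃ X : ℝ, 0 < X ∧ X ^ 2 = - φ e :=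
    ⟨√(-φ e), Real.sqrt_pos.2 (by linarith), Real.sq_sqrt (by linarith)⟩
  set ρ : ℝ := 1 - c e * φ e with hρ
  have hρ1 : 1 < ρ := by
    have := mul_neg_of_pos_of_neg hce hneg
    linarith
  obtain ⟨Y, hY, hY2⟩ : ∃ Y : ℝ, 0 < Y ∧ Y ^ 2 = c e * ρ := by
    have : 0 < c e * ρ := mul_pos hce (by linarith)
    exact ⟨√(c e * ρ), Real.sqrt_pos.2 this, Real.sq_sqrt this.le⟩
  -- sums split at e
  have split : ∀ (s t : ℝ) (z : Edge n → ℝ), ∑ j, φ j * (if j = e then s else t * z j) =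
      φ e * s + t * (∑ j, φ j * z j - φ e * z e) := by
    intro s t z
    rw [← Finset.add_sum_erase _ _ (Finset.mem_univ e), ← Finset.add_sum_erase (a := e) _ (fun j => φ j * z j) (Finset.mem_univ e),
      if_pos rfl, add_sub_cancel_left, Finset.mul_sum]
    congr 1
    apply Finset.sum_congr rfl
    intro j hj
    rw [if_neg (Finset.ne_of_mem_erase hj)]; ring
  set a : Edge n → ℝ := fun i => if i = e then -Y else X * c i with ha
  set b : Edge n → ℝ := fun i => if i = e then Y else X * c i with hb
  have φa : ∑ j, φ j * a j = Y * X ^ 2 + X * ρ := by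
    rw [ha, split, h1, hX2, hρ]; ring
  have φb : ∑ j, φ j * b j = - Y * X ^ 2 + X * ρ := by
    rw [hb, split, h1, hX2, hρ]; ring
  set μ : ℝ := 1 - 2 * ρ + 2 * X * Y with hμ
  set μ' : ℝ := 1 - 2 * ρ - 2 * X * Y with hμ'
  have hμμ : μ * μ' = 1 := by
    rw [hμ, hμ']
    have : φ e = - X ^ 2 := by linarith
    have hr : ρ = 1 + c e * X ^ 2 := by rw [hρ, this]; ring
    have : (1 - 2 * ρ + 2 * X * Y) * (1 - 2 * ρ - 2 * X * Y) = (1 - 2 * ρ) ^ 2 - 4 * X ^ 2 * Y ^ 2 := by ring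
    rw [this, hY2]
    linear_combination 4 * ρ * hr
  have hμ'1 : μ' < -1 := by
    have := mul_pos hX hY
    rw [hμ']; nlinarith
  have hrb : ∀ i, b i - 2 * (∑ j, φ j * b j) * c i = μ * a i := by
    intro i
    rw [φb]
    simp only [ha, hb]
    split_ifs with h
    · rw [h, hμ]
      have hr : ρ = 1 + c e * X ^ 2 := by rw [hρ, hX2]; ring
      linear_combination -2 * Y * hr + 2 * X * hY2
    · rw [hμ]; ring
  have hra : ∀ i, a i - 2 * (∑ j, φ j * a j) * c i = μ' * b i := by
    intro i
    rw [φa]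
    simp only [ha, hb]
    split_ifs with h
    · rw [h, hμ']
      have hr : ρ = 1 + c e * X ^ 2 := by rw [hρ, hX2]; ring
      linear_combination 2 * Y * hr + 2 * X * hY2
    · rw [hμ']; ring
  have core : ∀ y : Edge n → ℝ, X ^ 2 * y e * (∑ i, (if i = e then 0 else c i) * (2 * y i * De i y)) +
      c e * (∑ j, φ j * y j - φ e * y e) * (2 * y e * De e y) = 0 := by
    intro y
    set u : ℝ := ((∑ j, φ j * y j - φ e * y e) / (X * ρ) - y e / Y) / 2 with hu
    set v : ℝ := ((∑ j, φ j * y j - φ e * y e) / (X * ρ) + y e / Y) / 2 with hv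
    have hX0 := hX.ne'
    have hY0 := hY.ne'
    have hρ0 : ρ ≠ 0 := by linarith
    have huv : (u + v) * (X * ρ) = ∑ j, φ j * y j - φ e * y e := by
      rw [hu, hv]; field_simp; ring
    have hvu : (v - u) * Y = y e := by
      rw [hu, hv]; field_simp; ring
    set y0 : Edge n → ℝ := fun i => y i - u * a i - v * b i with hy0
    have y0e : y0 e = 0 := by
      simp only [hy0, ha, hb, if_true]
      linear_combination -hvu
    have φl : ∀ (z : Edge n → ℝ) (s t : ℝ), ∑ j, φ j * (z j + s * a j + t * b j) =
        ∑ j, φ j * z j + s * (∑ j, φ j * a j) + t * (∑ j, φ j * b j) := by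
      intro z s t
      rw [Finset.mul_sum, Finset.mul_sum, ← Finset.sum_add_distrib, ← Finset.sum_add_distrib]
      exact Finset.sum_congr rfl fun _ _ => by ring
    have φ0 : ∑ j, φ j * y0 j = 0 := by
      have := φl y (-u) (-v)
      have e0 : ∑ j, φ j * y0 j = ∑ j, φ j * (y j + (-u) * a j + (-v) * b j) :=
        Finset.sum_congr rfl fun _ _ => by simp only [hy0]; ring
      rw [e0, this, φa, φb]
      linear_combination -huv + X ^ 2 * hvu + y e * hX2
    have H : ∀ u v, PP (fun i => y0 i + u * a i + v * b i) = PP (fun i => y0 i + μ * u * a i + μ' * v * b i) := by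
      intro u v
      have e1 : PP (fun i => y0 i + u * a i + v * b i) = PP (fun i => y0 i + v * a i + u * b i) := by
        rw [← PP_flip e]
        congr 1
        funext i
        simp only [flip, ha, hb]
        split_ifs with h
        · rw [h, y0e]; ring
        · ring
      rw [e1, ← hinv, φl, φ0]
      congr 1
      funext i
      linear_combination v * hra i + u * hrb i
    have fin := dih_core hn y0 a b μ μ' hμμ hμ'1 H u v
    have ey : (fun i => y0 i + u * a i + v * b i) = y := by
      funext i; simp only [hy0]; ring
    rw [ey] at fin
    simp only [pderiv_Pex] at fin
    have e2 : ∀ i, v * b i - u * a i = (v - u) * X * (if i = e then 0 else c i) + (if i = e then (u + v) * Y else 0) := by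
      intro i
      simp only [ha, hb]
      split_ifs <;> ring
    simp only [e2, add_mul, Finset.sum_add_distrib, ite_mul, zero_mul, Finset.sum_ite_eq', Finset.mem_univ, if_true] at fin
    have e3 : ∑ i, (v - u) * X * (if i = e then 0 else c i) * (2 * y i * De i y) =
        (v - u) * X * ∑ i, (if i = e then 0 else c i) * (2 * y i * De i y) := by
      rw [Finset.mul_sum]
      exact Finset.sum_congr rfl fun _ _ => by ring
    rw [e3] at fin
    generalize (∑ i, (if i = e then 0 else c i) * (2 * y i * De i y)) = S at fin ⊢
    rw [← huv]
    rw [← hvu]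
    rw [← hvu] at fin
    have : ρ * c e = Y ^ 2 := by rw [hY2]; ring
    linear_combination X * Y * fin + (u + v) * X * 2 * ((v - u) * Y) * De e y * this
  have core2 := sep (fun i y => if i = e then 0 else X ^ 2 * c i * De i y + c e * φ i * De e y)
    (fun i f y => by simp only [De_flip]) (fun y hy => by
      have h0 := core y
      have h2 : (2 * y e) * ∑ i, y i * (if i = e then 0 else X ^ 2 * c i * De i y + c e * φ i * De e y) = 0 := by
        refine Eq.trans ?_ h0
        rw [← Finset.add_sum_erase _ (fun i => y i * _) (Finset.mem_univ e),
          ← Finset.add_sum_erase _ (fun i => _ * (2 * y i * De i y)) (Finset.mem_univ e),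
          ← Finset.add_sum_erase _ (fun i => φ i * y i) (Finset.mem_univ e), if_pos rfl, if_pos rfl, mul_zero, zero_add,
          zero_mul, zero_add, add_sub_cancel_left, Finset.mul_sum, Finset.mul_sum, Finset.mul_sum,
          Finset.sum_mul, ← Finset.sum_add_distrib]
        apply Finset.sum_congr rfl
        intro i hi
        rw [if_neg (Finset.ne_of_mem_erase hi), if_neg (Finset.ne_of_mem_erase hi)]
        ring
      exact (mul_eq_zero.1 h2).resolve_left (mul_ne_zero two_ne_zero (hy e)))
  have c0 : ∀ j, j ≠ e → c j = 0 := by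
    intro j hj
    have := De_indep (fun i => (if i = j then X ^ 2 * c j else 0) + (if i = e then c e * φ j else 0)) (fun y hy => by
      have := core2 j y hy
      simp only [if_neg hj] at this
      simpa [add_mul, Finset.sum_add_distrib] using this) j
    simp only [if_true, if_neg hj, add_zero] at this
    exact (mul_eq_zero.1 this).resolve_left (pow_ne_zero 2 hX.ne')
  rw [Finset.sum_eq_single e (fun j _ hj => by rw [c0 j hj, mul_zero]) (by simp)] at h1
  have := mul_neg_of_neg_of_pos hneg hce
  linarith
end CIC
end

section
namespace CIC
open MvPolynomial

theorem flip_flip {n : ℕ} (e : Edge n) (y : Edge n → ℝ) : flip e (flip e y) = y := by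
  funext i
  simp only [flip]; split_ifs <;> ring

def LL {k n : ℕ} (G : Edge k → Edge n → ℝ) (x : Edge n → ℝ) (e : Edge k) : ℝ := ∑ f, G e f * x f

theorem LL_flip {k n : ℕ} (G : Edge k → Edge n → ℝ) (x : Edge n → ℝ) (f : Edge n) :
    LL G (flip f x) = fun e => LL G x e - 2 * x f * G e f := by
  funext e
  have : ∀ i, G e i * flip f x i = G e i * x i - if i = f then 2 * x f * G e f else 0 := by
    intro i
    simp only [flip]
    split_ifs with h
    · subst h; ring
    · ring
  simp only [LL, this, Finset.sum_sub_distrib, Finset.sum_ite_eq', Finset.mem_univ, if_true]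

theorem LL_add {k n : ℕ} (G : Edge k → Edge n → ℝ) (x v : Edge n → ℝ) (t : ℝ) (e : Edge k) :
    LL G (fun i => x i + t * v i) e = LL G x e + t * LL G v e := by
  simp only [LL, Finset.mul_sum, ← Finset.sum_add_distrib]
  exact Finset.sum_congr rfl fun _ _ => by ring

theorem step5 {k n : ℕ} (hk : 1 ≤ k) (G : Edge k → Edge n → ℝ) (B : Edge n → Edge k → ℝ)
    (hG : ∀ e f, 0 ≤ G e f) (hB : ∀ y, LL G (fun f => ∑ e, B f e * y e) = y)
    (hfl : ∀ f x, PP (LL G (flip f x)) = PP (LL G x)) :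
    ∃ (F : Edge k → Edge n) (c : Edge k → ℝ), Function.Injective F ∧ (∀ e, 0 < c e) ∧
      ∀ x e, LL G x e = c e * x (F e) := by
  have hker : ∀ v, (∀ e, LL G v e = 0) → ∀ f e, v f * G e f = 0 := by
    intro v hv f e
    have := lineal (fun e => -2 * (v f * G e f)) (fun y _ => by
      simp only [← pderiv_Pex]
      apply line_const (Pex k) y _ (PP (LL G (flip f (fun f => ∑ e, B f e * y e))))
      intro t
      rw [eval_Pex]
      have h1 := hfl f (fun i => flip f (fun f => ∑ e, B f e * y e) i + t * v i)
      have e1 : LL G (fun i => flip f (fun f => ∑ e, B f e * y e) i + t * v i) =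
          LL G (flip f (fun f => ∑ e, B f e * y e)) := by
        funext e
        rw [LL_add, hv, mul_zero, add_zero]
      rw [e1] at h1
      rw [← h1]
      congr 1
      have e2 : flip f (fun i => flip f (fun f => ∑ e, B f e * y e) i + t * v i) =
          fun i => (fun f => ∑ e, B f e * y e) i + t * flip f v i := by
        funext i
        simp only [flip]
        split_ifs <;> ring
      rw [e2]
      funext e
      rw [LL_add, hB, LL_flip]
      simp only [hv]
      ring) e
    linarith
  have hφ : ∀ f, (∃ e, G e f ≠ 0) → ∀ x, ∑ j, B f j * LL G x j = x f := by
    rintro f ⟨e, he⟩ x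
    have := hker (fun i => (∑ j, B i j * LL G x j) + (-1) * x i) (fun e => by
      rw [LL_add, hB]; ring) f e
    rcases mul_eq_zero.1 this with h | h
    · linarith
    · exact absurd h he
  have hcol : ∀ f x, LL G (fun i => if i = f then x else 0) = fun e => G e f * x := by
    intro f x; funext e
    simp [LL]
  have hpos : ∀ f, (∃ e, G e f ≠ 0) → ∀ e, 0 ≤ B f e := by
    intro f hf e
    refine dih hk (fun e => G e f) (B f) (fun e => hG e f) ?_ ?_ e
    · have := hφ f hf (fun i => if i = f then 1 else 0)
      rw [hcol] at this
      simpa using this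
    · intro y
      have := hfl f (fun f => ∑ e, B f e * y e)
      rw [LL_flip, hB] at this
      exact this
  have hterm : ∀ e f e', 0 ≤ G e f * B f e' := by
    intro e f e'
    by_cases h : G e f = 0
    · rw [h, zero_mul]
    · exact mul_nonneg (hG e f) (hpos f ⟨e, h⟩ e')
  have hdel : ∀ e e', ∑ f, G e' f * B f e = if e' = e then 1 else 0 := by
    intro e e'
    have := congrFun (hB (fun i => if i = e then 1 else 0)) e'
    simpa [LL] using this
  have hex : ∀ e, ∃ f, 0 < G e f * B f e := by
    intro e
    have h1 := hdel e e
    rw [if_pos rfl] at h1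
    by_contra hcon
    push Not at hcon
    have := Finset.sum_nonpos (s := Finset.univ) (f := fun f => G e f * B f e) (fun i _ => hcon i)
    linarith
  choose F hF using hex
  have hGp : ∀ e, 0 < G e (F e) := fun e =>
    lt_of_le_of_ne (hG _ _) (fun h => by have := hF e; rw [← h, zero_mul] at this; exact lt_irrefl _ this)
  have hBp : ∀ e, 0 < B (F e) e := fun e => (mul_pos_iff_of_pos_left (hGp e)).1 (hF e)
  have h2 : ∀ e e', e' ≠ e → G e' (F e) = 0 := by
    intro e e' he
    have h1 := hdel e e'
    rw [if_neg he, Finset.sum_eq_zero_iff_of_nonneg (fun f _ => hterm _ _ _)] at h1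
    exact (mul_eq_zero.1 (h1 (F e) (Finset.mem_univ _))).resolve_right (hBp e).ne'
  refine ⟨F, fun e => G e (F e), ?_, hGp, ?_⟩
  · intro e e' h
    by_contra hne
    have := h2 e' e hne
    rw [← h] at this
    exact (hGp e).ne' this
  · intro x e
    rw [LL]
    apply Finset.sum_eq_single_of_mem _ (Finset.mem_univ _)
    intro f' _ hf'
    have h1 := hφ (F e) ⟨e, (hGp e).ne'⟩ (fun i => if i = f' then 1 else 0)
    rw [hcol] at h1
    simp only [mul_one, if_neg (Ne.symm hf')] at h1
    rw [Finset.sum_eq_zero_iff_of_nonneg (fun j _ => mul_nonneg (hpos _ ⟨e, (hGp e).ne'⟩ j) (hG _ _))] at h1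
    rw [(mul_eq_zero.1 (h1 e (Finset.mem_univ _))).resolve_left (hBp e).ne', zero_mul]
end CIC
end

section
namespace CIC
open MvPolynomial

noncomputable def TT {k n : ℕ} (F : Edge k → Edge n) (c : Edge k → ℝ) : MvPolynomial (Edge n) ℝ :=
  aeval (fun e => C (c e ^ 2) * X (F e)) (Pm ℝ k)

theorem eval_TT {k n : ℕ} (F : Edge k → Edge n) (c : Edge k → ℝ) (m : Edge n → ℝ) :
    eval m (TT F c) = eval (fun e => c e ^ 2 * m (F e)) (Pm ℝ k) := by
  rw [TT, eval_aeval]; simp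

theorem TT_hom {k n : ℕ} (hk : 1 ≤ k) (F : Edge k → Edge n) (c : Edge k → ℝ) :
    (TT F c).IsHomogeneous (k - 1) := by
  rw [TT]
  have := (Pm_hom ℝ k hk).aeval (fun e => C (c e ^ 2) * X (F e) : Edge k → MvPolynomial (Edge n) ℝ) (n := 1)
    (fun e => by
      have := (isHomogeneous_C (Edge n) (c e ^ 2)).mul (isHomogeneous_X ℝ (F e))
      simpa using this)
  simpa using this

theorem dTT {k n : ℕ} (F : Edge k → Edge n) (c : Edge k → ℝ) (m : Edge n → ℝ) (f : Edge n) :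
    eval m (pderiv f (TT F c)) =
      ∑ i, eval (fun e => c e ^ 2 * m (F e)) (pderiv i (Pm ℝ k)) * (if F i = f then c i ^ 2 else 0) := by
  rw [TT, chain, map_sum]
  apply Finset.sum_congr rfl
  intro i _
  rw [map_mul, eval_aeval]
  congr 1
  · simp
  · rw [Derivation.leibniz]
    simp [pderiv_X, Pi.single_apply]
    split_ifs with h1 h2 h3 <;> simp_all

theorem dTT_ne {k n : ℕ} (F : Edge k → Edge n) (hF : Function.Injective F) (c : Edge k → ℝ)
    (hc : ∀ e, 0 < c e) (e : Edge k) : pderiv (F e) (TT F c) ≠ 0 := by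
  intro h
  obtain ⟨m, hm⟩ : ∃ m : Edge n → ℝ, ∀ e', m (F e') = me e e' / c e' ^ 2 :=
    ⟨Function.extend F (fun e' => me e e' / c e' ^ 2) 0, fun e' => hF.extend_apply _ _ _⟩
  have h1 := dTT F c m (F e)
  rw [h, map_zero, Finset.sum_eq_single e] at h1
  · have e1 : (fun e' => c e' ^ 2 * m (F e')) = me e := by
      funext e'
      rw [hm, mul_div_cancel₀]
      exact pow_ne_zero 2 (hc e').ne'
    rw [e1, if_pos rfl] at h1
    exact mul_ne_zero (me_grad e) (pow_ne_zero 2 (hc e).ne') h1.symm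
  · intro i _ hi
    rw [if_neg (fun h => hi (hF h)), mul_zero]
  · simp

noncomputable def qX (n d : ℕ) : Fin n → Fin d → MvPolynomial (Fin n × Fin d) ℝ := fun i k => X (i, k)

theorem eval_sqm {n d : ℕ} (q : Fin n × Fin d → ℝ) (e : Edge n) :
    eval q (sqm (qX n d) e) = sqm (fun i k => q (i, k)) e := by
  obtain ⟨a, b, h, rfl⟩ := edge_ex e
  simp [sqm, dl_edge, qX]

theorem deg_bound {d n : ℕ} (T : MvPolynomial (Edge n) ℝ) (hT : T.IsHomogeneous (d + 1))
    (H : ∀ q : Fin n → Fin d → ℝ, eval (sqm q) T = 0) (v : Fin n) (σ : Fin d → Fin n)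
    (hσ : Function.Injective σ) (hσv : ∀ i, v ≠ σ i)
    (hN : ∀ u (h : v ≠ u), (∀ i, u ≠ σ i) → pderiv (edge v u h) T = 0) (i0 : Fin d) :
    pderiv (edge v (σ i0) (hσv i0)) T = 0 := by
  classical
  refine dgl (κ := Fin d) _ (hT.pderiv) (by simp) ?_
  set A : (Fin n → Fin d → ℝ) → Matrix (Fin d) (Fin d) ℝ := fun q => Matrix.of fun i k => q v k - q (σ i) k with hA
  have key : ∀ q : Fin n → Fin d → ℝ, eval (sqm q) (pderiv (edge v (σ i0) (hσv i0)) T) * (A q).det = 0 := by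
    intro q
    set ξ : Fin d → ℝ := fun k => (A q).adjugate k i0 with hξ
    have hAx : ∀ i, ∑ k, (q v k - q (σ i) k) * ξ k = if i = i0 then (A q).det else 0 := by
      intro i
      have := congrFun (congrFun (Matrix.mul_adjugate (A q)) i) i0
      rw [Matrix.mul_apply] at this
      simpa [Matrix.one_apply, hA, hξ] using this
    set qt : Fin n → Fin d → Polynomial ℝ := fun i k =>
      Polynomial.C (q i k) + (if i = v then Polynomial.C (ξ k) * Polynomial.X else 0) with hqt
    have hev : ∀ t e, (sqm qt e).eval t = sqm (fun i k => (qt i k).eval t) e := by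
      intro t e
      obtain ⟨a, b, h, rfl⟩ := edge_ex e
      simp [sqm, dl_edge, Polynomial.eval_finsetSum]
    have h0 : aeval (sqm qt) T = 0 := by
      apply Polynomial.funext
      intro t
      rw [eval_poly]
      simp only [hev]
      rw [Polynomial.eval_zero]
      exact H _
    have h1 := poly_deriv (sqm qt) T 0
    rw [h0] at h1
    simp only [Polynomial.derivative_zero, Polynomial.eval_zero, hev] at h1
    have e0 : (fun i k => (qt i k).eval 0) = q := by
      funext i k
      simp only [hqt]
      split_ifs <;> simp
    rw [e0] at h1
    have hd : ∀ a b (h : a ≠ b), b ≠ v → (Polynomial.derivative (sqm qt (edge a b h))).eval 0 =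
        if a = v then 2 * ∑ k, (q a k - q b k) * ξ k else 0 := by
      intro a b h hb
      simp only [sqm, dl_edge, Polynomial.derivative_sum, Polynomial.eval_finsetSum, hqt, if_neg hb]
      split_ifs with ha
      · rw [Finset.mul_sum]
        apply Finset.sum_congr rfl
        intro k _
        simp [Polynomial.derivative_pow]
        ring
      · apply Finset.sum_eq_zero
        intro k _
        simp [Polynomial.derivative_pow]
    rw [Finset.sum_eq_single (edge v (σ i0) (hσv i0))] at h1
    · rw [hd _ _ _ (hσv i0).symm, if_pos rfl, hAx, if_pos rfl] at h1
      linarith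
    · intro e _ he
      by_cases hve : v ∈ e.1
      · obtain ⟨u, hu⟩ := hve
        have hvu : v ≠ u := by
          rintro rfl
          exact e.2 (by rw [hu]; simp)
        have hee : e = edge v u hvu := Subtype.ext hu
        subst hee
        by_cases hi : ∃ i, u = σ i
        · obtain ⟨i, rfl⟩ := hi
          have : i ≠ i0 := by
            rintro rfl
            exact he rfl
          rw [hd _ _ _ hvu.symm, if_pos rfl, hAx, if_neg this]
          ring
        · push Not at hi
          rw [hN u hvu hi]; simp
      · obtain ⟨a, b, h, rfl⟩ := edge_ex e
        have ha : a ≠ v := by rintro rfl; exact hve (Sym2.mem_mk_left _ _)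
        have hb : b ≠ v := by rintro rfl; exact hve (Sym2.mem_mk_right _ _)
        rw [hd _ _ _ hb, if_neg ha, mul_zero]
    · simp
  set Δ : MvPolynomial (Fin n × Fin d) ℝ := (Matrix.of fun i k => qX n d v k - qX n d (σ i) k).det with hΔ
  have hΔe : ∀ q, eval q Δ = (A (fun i k => q (i, k))).det := by
    intro q
    rw [hΔ, RingHom.map_det]
    congr 1
    ext i k
    simp [hA, qX]
  have hΔ0 : Δ ≠ 0 := by
    intro h
    have := hΔe (fun ik => if ∃ j, ik.1 = σ j ∧ ik.2 = j then -1 else 0)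
    rw [h, map_zero] at this
    have e1 : A (fun i k => if ∃ j, i = σ j ∧ k = j then -1 else 0) = 1 := by
      ext i k
      simp only [hA, Matrix.of_apply, Matrix.one_apply]
      rw [if_neg (by rintro ⟨j, hj, _⟩; exact hσv j hj)]
      by_cases hik : i = k
      · subst hik
        rw [if_pos ⟨i, rfl, rfl⟩, if_pos rfl]; ring
      · rw [if_neg (by rintro ⟨j, hj, hj'⟩; exact hik ((hσ hj).trans hj'.symm)), if_neg hik]; ring
    simp only [e1, Matrix.det_one] at this
    exact zero_ne_one this
  have hprod : aeval (sqm (qX n d)) (pderiv (edge v (σ i0) (hσv i0)) T) * Δ = 0 := by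
    apply MvPolynomial.funext
    intro q
    rw [map_mul, eval_aeval, hΔe, map_zero]
    simp only [eval_sqm]
    exact key _
  have := (mul_eq_zero.1 hprod).resolve_right hΔ0
  intro q
  have h2 := congrArg (eval (fun ik : Fin n × Fin d => q ik.1 ik.2)) this
  rw [eval_aeval, map_zero] at h2
  simpa only [eval_sqm] using h2

def emap {k n : ℕ} (ι : Fin k → Fin n) (hι : Function.Injective ι) (e : Edge k) : Edge n :=
  ⟨e.1.map ι, by
    obtain ⟨⟨a, b⟩, he⟩ := e
    intro h
    apply he
    exact hι h⟩

theorem emap_edge {k n : ℕ} (ι : Fin k → Fin n) (hι : Function.Injective ι) (a b : Fin k) (h : a ≠ b) :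
    emap ι hι (edge a b h) = edge (ι a) (ι b) (hι.ne h) := rfl

theorem step6 {d n : ℕ} (hn : d + 2 ≤ n) (F : Edge (d + 2) → Edge n) (hF : Function.Injective F)
    (c : Edge (d + 2) → ℝ) (hc : ∀ e, 0 < c e)
    (H : ∀ q : Fin n → Fin d → ℝ, eval (sqm q) (TT F c) = 0) :
    ∃ (ι : Fin (d + 2) → Fin n) (hι : Function.Injective ι) (F' : Edge (d + 2) → Edge (d + 2)),
      Function.Bijective F' ∧ ∀ e, F e = emap ι hι (F' e) := by
  classical
  let G : SimpleGraph (Fin n) :=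
    { Adj := fun a b => ∃ (h : a ≠ b) (e : Edge (d + 2)), F e = edge a b h
      symm := ⟨fun a b ⟨h, e, he⟩ => ⟨h.symm, e, by rw [he, edge_comm]⟩⟩
      loopless := ⟨fun a ⟨h, _⟩ => h rfl⟩ }
  have hdeg : ∀ v w, G.Adj v w → d + 1 ≤ G.degree v := by
    intro v w hvw
    by_contra hlt
    push Not at hlt
    obtain ⟨U, hU1, hU2, hU3⟩ := Finset.exists_subsuperset_card_eq (s := G.neighborFinset v)
      (t := Finset.univ.erase v) (n := d)
      (fun u hu => by
        rw [SimpleGraph.mem_neighborFinset] at hu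
        simp [hu.ne.symm])
      (by rw [SimpleGraph.card_neighborFinset_eq_degree]; omega)
      (by rw [Finset.card_erase_of_mem (Finset.mem_univ _)]; simp; omega)
    let eq := (U.equivFinOfCardEq hU3).symm
    have hwU : w ∈ U := hU1 (by simpa using hvw)
    have hσv : ∀ i, v ≠ (eq i : Fin n) := fun i => by
      have := hU2 (eq i).2
      exact (Finset.ne_of_mem_erase this).symm
    have := deg_bound (TT F c) (by simpa using TT_hom (by omega) F c) H v (fun i => (eq i : Fin n))
      (fun i j h => eq.injective (Subtype.ext h)) hσv (fun u h hu => by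
        have hnot : ¬ G.Adj v u := by
          intro hadj
          have hu' : u ∈ U := hU1 (by simpa using hadj)
          exact hu (eq.symm ⟨u, hu'⟩) (by simp)
        apply MvPolynomial.funext
        intro m
        rw [dTT, map_zero]
        apply Finset.sum_eq_zero
        intro i _
        rw [if_neg (fun hi => hnot ⟨h, i, hi⟩), mul_zero]) (eq.symm ⟨w, hwU⟩)
    obtain ⟨h, e, he⟩ := hvw
    have h3 : edge v (eq (eq.symm ⟨w, hwU⟩) : Fin n) (hσv _) = F e := by
      rw [he]; simp
    rw [h3] at this
    exact dTT_ne F hF c hc e this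
  -- counting
  have hcard : G.edgeFinset.card = (d + 2).choose 2 := by
    have h1 : G.edgeFinset = Finset.univ.image (fun e => (F e).1) := by
      ext x
      induction x with
      | _ a b =>
        simp only [SimpleGraph.mem_edgeFinset, SimpleGraph.mem_edgeSet, Finset.mem_image, Finset.mem_univ, true_and]
        constructor
        · rintro ⟨h, e, he⟩
          exact ⟨e, by rw [he]; rfl⟩
        · rintro ⟨e, he⟩
          have hab : a ≠ b := by
            have := (F e).2
            rw [he] at this
            simpa using this
          exact ⟨hab, e, Subtype.ext he⟩
    rw [h1, Finset.card_image_of_injective _ (show Function.Injective (fun e => (F e).1) from Subtype.val_injective.comp hF), Finset.card_univ,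
      Sym2.card_subtype_not_diag]
    simp
  set V : Finset (Fin n) := Finset.univ.filter (fun v => ∃ w, G.Adj v w) with hV
  have hsum : ∑ v ∈ V, G.degree v = (d + 2) * (d + 1) := by
    have h1 := G.sum_degrees_eq_twice_card_edges
    rw [hcard] at h1
    have h2 : (d + 2).choose 2 * 2 = (d + 2) * (d + 1) := by
      rw [Nat.choose_two_right]
      exact Nat.div_mul_cancel (by simpa using (Nat.even_mul_pred_self (d + 2)).two_dvd)
    rw [← h2, mul_comm, ← h1]
    apply Finset.sum_subset (Finset.subset_univ _)
    intro v _ hv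
    rw [SimpleGraph.degree_eq_zero]
    intro w hw
    exact hv (by simp [hV]; exact ⟨w, hw⟩)
  have hV1 : V.card ≤ d + 2 := by
    have h1 : V.card • (d + 1) ≤ ∑ v ∈ V, G.degree v := Finset.card_nsmul_le_sum _ _ _ (fun v hv => by
      obtain ⟨w, hw⟩ := (Finset.mem_filter.1 hv).2
      exact hdeg v w hw)
    rw [hsum, smul_eq_mul] at h1
    exact Nat.le_of_mul_le_mul_right h1 (by omega)
  have hV2 : d + 2 ≤ V.card := by
    obtain ⟨a, b, h, hab⟩ := edge_ex (F (edge 0 1 (by simp)))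
    have hadj : G.Adj a b := ⟨h, _, hab⟩
    have h1 := hdeg a b hadj
    have h2 : insert a (G.neighborFinset a) ⊆ V := by
      intro x hx
      rw [Finset.mem_insert] at hx
      rw [hV, Finset.mem_filter]
      refine ⟨Finset.mem_univ _, ?_⟩
      rcases hx with rfl | hx
      · exact ⟨b, hadj⟩
      · exact ⟨a, ((G.mem_neighborFinset a x).1 hx).symm⟩
    have h3 := Finset.card_le_card h2
    rw [Finset.card_insert_of_notMem (by simp), SimpleGraph.card_neighborFinset_eq_degree] at h3
    omega
  let eq := (V.equivFinOfCardEq (le_antisymm hV1 hV2)).symm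
  have hι : Function.Injective (fun i => (eq i : Fin n)) := fun i j h => eq.injective (Subtype.ext h)
  have hex : ∀ e, ∃ e', F e = emap _ hι e' := by
    intro e
    obtain ⟨a, b, h, hab⟩ := edge_ex (F e)
    have hadj : G.Adj a b := ⟨h, _, hab⟩
    have ha : a ∈ V := by rw [hV, Finset.mem_filter]; exact ⟨Finset.mem_univ _, b, hadj⟩
    have hb : b ∈ V := by rw [hV, Finset.mem_filter]; exact ⟨Finset.mem_univ _, a, hadj.symm⟩
    refine ⟨edge (eq.symm ⟨a, ha⟩) (eq.symm ⟨b, hb⟩) (by simpa using h), ?_⟩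
    rw [hab, emap_edge, edge_inj]
    simp
  choose F' hF' using hex
  refine ⟨_, hι, F', Finite.injective_iff_bijective.1 (fun x y hxy => hF ?_), hF'⟩
  rw [hF', hF', hxy]
end CIC
end

section
namespace CIC
open MvPolynomial

theorem mm_smulF {n : ℕ} (m : Edge n → ℝ) (a b : Fin n) (h : a ≠ b) : mm m a b = m (edge a b h) := mm_ne m a b h

theorem lam_step {n : ℕ} (F : Edge n → Edge n) (hF : Function.Injective F) (c : Edge n → ℝ)
    (hc : ∀ e, 0 < c e) (κ : ℝ) (hκ : TT F c = C κ * Pm ℝ n) (a b : Fin n) (hab : a ≠ b)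
    (i j : Fin n) (hij : i ≠ j) (hf : F (edge a b hab) = edge i j hij) (m : Edge n → ℝ) (hm : Lam i j m)
    (hg : eval m (pderiv (edge i j hij) (Pm ℝ n)) ≠ 0) :
    Lam a b (fun e => c e ^ 2 * m (F e)) := by
  have hκ0 : κ ≠ 0 := by
    rintro rfl
    apply dTT_ne F hF c hc (edge a b hab)
    rw [hκ]; simp
  have hgr : ∀ e, eval (fun e => c e ^ 2 * m (F e)) (pderiv e (Pm ℝ n)) * c e ^ 2 =
      κ * eval m (pderiv (F e) (Pm ℝ n)) := by
    intro e
    have h1 := dTT F c m (F e)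
    rw [hκ, Finset.sum_eq_single e, if_pos rfl] at h1
    · rw [← h1, pderiv_C_mul, map_mul, eval_C]
    · intro i _ hi
      rw [if_neg (fun h => hi (hF h)), mul_zero]
    · simp
  apply grad_single _ _ a b hab
  · intro h0
    have := hgr (edge a b hab)
    rw [h0, hf, zero_mul] at this
    exact mul_ne_zero hκ0 hg this.symm
  · intro f hf'
    have := hgr f
    rw [Lam_grad hij hm (F f) (fun h => hf' (hF (h.trans hf.symm))), mul_zero] at this
    exact (mul_eq_zero.1 this).resolve_right (pow_ne_zero 2 (hc f).ne')
  · rw [← eval_Pm, ← eval_TT, hκ, map_mul, eval_Pm, Lam_det hij hm, mul_zero]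

theorem pert {n : ℕ} (P : MvPolynomial (Edge n) ℝ) (m v : Edge n → ℝ) (h : eval m P ≠ 0) :
    ∃ t : ℝ, t ≠ 0 ∧ eval (fun e => m e + t * v e) P ≠ 0 := by
  by_contra hcon
  push Not at hcon
  set p : Polynomial ℝ := aeval (fun i => Polynomial.C (m i) + Polynomial.X * Polynomial.C (v i)) P with hp
  have hev : ∀ t, p.eval t = eval (fun e => m e + t * v e) P := by
    intro t
    rw [hp, eval_poly]
    simp only [Polynomial.eval_add, Polynomial.eval_mul, Polynomial.eval_C, Polynomial.eval_X]
  have : p = 0 := poly_zero_of_nat p (fun k => (k : ℝ) + 1) (fun x y hxy => by simpa using hxy) (fun k => by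
    rw [hev]
    exact hcon _ (by positivity))
  have h0 := hev 0
  rw [this] at h0
  simp at h0
  exact h h0.symm

theorem sw_edge {n : ℕ} (i j : Fin n) (e : Edge n) :
    emap (Equiv.swap i j) (Equiv.swap i j).injective (emap (Equiv.swap i j) (Equiv.swap i j).injective e) = e := by
  obtain ⟨a, b, h, rfl⟩ := edge_ex e
  simp [emap_edge]

theorem tri0 {n : ℕ} (F : Edge n → Edge n) (hF : Function.Injective F) (c : Edge n → ℝ)
    (hc : ∀ e, 0 < c e) (κ : ℝ) (hκ : TT F c = C κ * Pm ℝ n) (a b x : Fin n) (hab : a ≠ b)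
    (hax : a ≠ x) (hbx : b ≠ x)
    (i j : Fin n) (hij : i ≠ j) (hf : F (edge a b hab) = edge i j hij) :
    c (edge a x hax) = c (edge b x hbx) ∧
      F (edge b x hbx) = emap (Equiv.swap i j) (Equiv.swap i j).injective (F (edge a x hax)) := by
  have n1 : F (edge a x hax) ≠ edge i j hij := by
    rw [← hf]
    intro h
    have := hF h
    rw [edge_inj] at this
    grind
  have n2 : F (edge b x hbx) ≠ edge i j hij := by
    rw [← hf]
    intro h
    have := hF h
    rw [edge_inj] at this
    grind
  have n3 : F (edge b x hbx) ≠ F (edge a x hax) := by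
    intro h
    have := hF h
    rw [edge_inj] at this
    grind
  have h1 := (lam_step F hF c hc κ hκ a b hab i j hij hf (me (edge i j hij)) (me_Lam i j hij) (me_grad _)).2 x
  rw [mm_ne _ _ _ hax, mm_ne _ _ _ hbx] at h1
  simp only [me, if_neg n1, if_neg n2, mul_one] at h1
  have hcc : c (edge a x hax) = c (edge b x hbx) := by
    have := (hc (edge a x hax)).le
    exact (pow_left_inj₀ (hc _).le (hc _).le two_ne_zero).1 h1
  refine ⟨hcc, ?_⟩
  set τ := emap (Equiv.swap i j) (Equiv.swap i j).injective with hτ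
  have hττ : ∀ e, τ (τ e) = e := sw_edge i j
  set g := F (edge a x hax) with hg
  set v : Edge n → ℝ := fun e => if e = g ∨ e = τ g then 1 else 0 with hv
  have hvτ : ∀ e, v (τ e) = v e := by
    intro e
    simp only [hv]
    congr 1
    apply propext
    constructor
    · rintro (h | h)
      · right; rw [← h, hττ]
      · left; rw [← hττ e, h, hττ]
    · rintro (h | h)
      · right; rw [h]
      · left; rw [h, hττ]
  have hτij : τ (edge i j hij) = edge i j hij := by
    rw [hτ, emap_edge, edge_inj]; simp
  have hvL : ∀ t : ℝ, Lam i j (fun e => me (edge i j hij) e + t * v e) := by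
    intro t
    have hL := me_Lam i j hij
    have add : ∀ p q, mm (fun e => me (edge i j hij) e + t * v e) p q = mm (me (edge i j hij)) p q + t * mm v p q := by
      intro p q
      by_cases h : p = q
      · subst h; simp [mm_self]
      · simp [mm_ne _ _ _ h]
    have v0 : mm v i j = 0 := by
      rw [mm_ne _ _ _ hij, hv]
      simp only
      rw [if_neg]
      rintro (h | h)
      · exact n1 h.symm
      · apply n1
        rw [← hττ g, ← h, hτij]
    refine ⟨by rw [add, hL.1, v0]; ring, fun k => ?_⟩
    rw [add, add, hL.2 k]
    congr 2
    by_cases h1 : k = i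
    · subst h1; rw [mm_self, mm_comm, v0]
    · by_cases h2 : k = j
      · subst h2; rw [mm_self, v0]
      · rw [mm_ne _ _ _ (Ne.symm h1), mm_ne _ _ _ (Ne.symm h2), ← hvτ, hτ, emap_edge]
        congr 1
        rw [edge_inj]
        left
        exact ⟨Equiv.swap_apply_left _ _, Equiv.swap_apply_of_ne_of_ne h1 h2⟩
  obtain ⟨t, ht, hgr⟩ := pert _ _ v (me_grad (edge i j hij))
  have h2 := (lam_step F hF c hc κ hκ a b hab i j hij hf _ (hvL t) hgr).2 x
  rw [mm_ne _ _ _ hax, mm_ne _ _ _ hbx] at h2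
  rw [← hcc] at h2
  have h3 := mul_left_cancel₀ (pow_ne_zero 2 (hc _).ne') h2
  simp only [me] at h3
  rw [if_neg n1, if_neg n2] at h3
  have h4 : v (F (edge a x hax)) = v (F (edge b x hbx)) := mul_left_cancel₀ ht (add_left_cancel h3)
  simp only [hv] at h4
  rw [if_pos (Or.inl hg.symm)] at h4
  by_contra hne
  rw [if_neg] at h4
  · exact one_ne_zero h4
  · rintro (h | h)
    · exact n3 h
    · exact hne h

theorem tri {n : ℕ} (F : Edge n → Edge n) (hF : Function.Injective F) (c : Edge n → ℝ)
    (hc : ∀ e, 0 < c e) (κ : ℝ) (hκ : TT F c = C κ * Pm ℝ n) (a b x : Fin n) (hab : a ≠ b)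
    (hax : a ≠ x) (hbx : b ≠ x) :
    ∃ i j l, i ≠ j ∧ i ≠ l ∧ j ≠ l ∧ (F (edge a b hab)).1 = s(i, j) ∧ (F (edge a x hax)).1 = s(i, l) ∧
      (F (edge b x hbx)).1 = s(j, l) := by
  obtain ⟨i, j, hij, hf⟩ := edge_ex (F (edge a b hab))
  obtain ⟨-, h⟩ := tri0 F hF c hc κ hκ a b x hab hax hbx i j hij hf
  have n3 : F (edge b x hbx) ≠ F (edge a x hax) := by
    intro h
    have := hF h
    rw [edge_inj] at this
    grind
  have n1 : F (edge a x hax) ≠ edge i j hij := by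
    rw [← hf]
    intro h
    have := hF h
    rw [edge_inj] at this
    grind
  obtain ⟨g, k, hgk, hgk'⟩ := edge_ex (F (edge a x hax))
  rw [hgk', emap_edge] at h
  rw [hgk', h] at n3
  rw [hgk'] at n1
  rw [hf, hgk', h]
  rw [Ne, edge_inj] at n1 n3
  simp only [edge]
  by_cases g1 : g = i
  · subst g1
    have : k ≠ j := by grind
    refine ⟨g, j, k, hij, hgk, this.symm, rfl, rfl, ?_⟩
    rw [Equiv.swap_apply_left, Equiv.swap_apply_of_ne_of_ne hgk.symm this]
  by_cases g2 : g = j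
  · subst g2
    have : k ≠ i := by grind
    refine ⟨g, i, k, hij.symm, hgk, this.symm, Sym2.eq_swap, rfl, ?_⟩
    rw [Equiv.swap_apply_right, Equiv.swap_apply_of_ne_of_ne this hgk.symm]
  have g' : Equiv.swap i j g = g := Equiv.swap_apply_of_ne_of_ne g1 g2
  by_cases k1 : k = i
  · subst k1
    refine ⟨k, j, g, hij, hgk.symm, Ne.symm g2, rfl, Sym2.eq_swap, ?_⟩
    rw [g', Equiv.swap_apply_left, Sym2.eq_swap]
  by_cases k2 : k = j
  · subst k2
    refine ⟨k, i, g, hij.symm, hgk.symm, Ne.symm g1, Sym2.eq_swap, Sym2.eq_swap, ?_⟩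
    rw [g', Equiv.swap_apply_right, Sym2.eq_swap]
  exfalso
  apply n3
  left
  exact ⟨g', Equiv.swap_apply_of_ne_of_ne k1 k2⟩

theorem step9 {n : ℕ} (hn : 3 < n) (F : Edge n → Edge n) (hF : Function.Injective F) (c : Edge n → ℝ)
    (hc : ∀ e, 0 < c e) (κ : ℝ) (hκ : TT F c = C κ * Pm ℝ n) :
    ∃ (ι : Fin n → Fin n) (hι : Function.Injective ι) (s : ℝ), 0 < s ∧ (∀ e, F e = emap ι hι e) ∧ ∀ e, c e = s := by
  have T := tri F hF c hc κ hκ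
  have h1 : ∀ a, ∃ v, ∀ b (h : a ≠ b), v ∈ (F (edge a b h)).1 := by
    intro a
    obtain ⟨b0, hb0, -⟩ := Fin.exists_ne_and_ne_of_two_lt a a (by omega)
    obtain ⟨b1, hb1, hb1'⟩ := Fin.exists_ne_and_ne_of_two_lt a b0 (by omega)
    obtain ⟨i, j, l, hij, hil, hjl, f1, f2, f3⟩ := T a b0 b1 hb0.symm hb1.symm hb1'.symm
    refine ⟨i, fun b h => ?_⟩
    by_cases e0 : b = b0
    · subst e0; rw [f1]; simp
    by_cases e1 : b = b1
    · subst e1; rw [f2]; simp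
    by_contra hi
    obtain ⟨i', j', l', -, -, -, g1, g2, -⟩ := T a b b0 h hb0.symm e0
    obtain ⟨i'', j'', l'', -, -, -, g3, g4, -⟩ := T a b b1 h hb1.symm e1
    have m1 : i' ∈ (F (edge a b h)).1 := by rw [g1]; simp
    have m2 : i' ∈ (F (edge a b0 hb0.symm)).1 := by rw [g2]; simp
    have m3 : i'' ∈ (F (edge a b h)).1 := by rw [g3]; simp
    have m4 : i'' ∈ (F (edge a b1 hb1.symm)).1 := by rw [g4]; simp
    rw [f1, Sym2.mem_iff] at m2
    rw [f2, Sym2.mem_iff] at m4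
    rcases m2 with rfl | rfl
    · exact hi m1
    rcases m4 with rfl | rfl
    · exact hi m3
    have := (Sym2.mem_and_mem_iff hjl).1 ⟨m1, m3⟩
    rw [← f3] at this
    have := hF (Subtype.ext this)
    rw [edge_inj] at this
    grind
  choose ι hι using h1
  have hinj : Function.Injective ι := by
    intro a b hab
    by_contra hne
    obtain ⟨x, hx, hx'⟩ := Fin.exists_ne_and_ne_of_two_lt a b (by omega)
    obtain ⟨i, j, l, hij, hil, hjl, f1, f2, f3⟩ := T a b x hne hx.symm hx'.symm
    have m1 := hι a b hne
    have m2 := hι a x hx.symm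
    have m3 := hι b x hx'.symm
    rw [← hab] at m3
    rw [f1, Sym2.mem_iff] at m1
    rw [f2, Sym2.mem_iff] at m2
    rw [f3, Sym2.mem_iff] at m3
    grind
  have hcc : ∀ a b x (ha : a ≠ x) (hb : b ≠ x), c (edge a x ha) = c (edge b x hb) := by
    intro a b x ha hb
    by_cases hab : a = b
    · subst hab; rfl
    · obtain ⟨i, j, hij, hf⟩ := edge_ex (F (edge a b hab))
      exact (tri0 F hF c hc κ hκ a b x hab ha hb i j hij hf).1
  obtain ⟨z, o, hzo⟩ : ∃ z o : Fin n, z ≠ o := ⟨⟨0, by omega⟩, ⟨1, by omega⟩, by simp⟩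
  refine ⟨ι, hinj, c (edge z o hzo), hc _, ?_, ?_⟩
  · intro e
    obtain ⟨a, b, h, rfl⟩ := edge_ex e
    rw [emap_edge]
    apply Subtype.ext
    apply (Sym2.mem_and_mem_iff (hinj.ne h)).1
    refine ⟨hι a b h, ?_⟩
    rw [edge_comm]
    exact hι b a h.symm
  · intro e
    obtain ⟨a, b, h, rfl⟩ := edge_ex e
    by_cases hb : b = o
    · subst hb
      exact hcc _ _ _ _ _
    · rw [hcc a o b h (Ne.symm hb), edge_comm, hcc b z o hb hzo]
end CIC
end

section
namespace CIC

theorem eudist_eq {d : ℕ} (x y : Fin d → ℝ) :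
    eudist x y = ‖(WithLp.toLp 2 x - WithLp.toLp 2 y : EuclideanSpace ℝ (Fin d))‖ := by
  rw [EuclideanSpace.norm_eq, eudist]
  congr 1
  apply Finset.sum_congr rfl
  intro k _
  simp

theorem iso_ext {V : Type*} [NormedAddCommGroup V] [InnerProductSpace ℝ V] [FiniteDimensional ℝ V] {k : ℕ}
    (u z : Fin k → V) (h : ∀ s t, inner ℝ (u s) (u t) = inner ℝ (z s) (z t)) :
    ∃ L : V →ₗᵢ[ℝ] V, ∀ t, L (u t) = z t := by
  classical
  let A : (Fin k → ℝ) →ₗ[ℝ] V := Fintype.linearCombination ℝ u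
  let Z : (Fin k → ℝ) →ₗ[ℝ] V := Fintype.linearCombination ℝ z
  have hAZ : ∀ a, ‖A a‖ = ‖Z a‖ := by
    intro a
    have : inner ℝ (A a) (A a) = inner ℝ (Z a) (Z a) := by
      simp only [A, Z, Fintype.linearCombination_apply, sum_inner, inner_sum, inner_smul_left, inner_smul_right, h]
    rw [real_inner_self_eq_norm_sq, real_inner_self_eq_norm_sq] at this
    exact (pow_left_inj₀ (norm_nonneg _) (norm_nonneg _) two_ne_zero).1 this
  have hker : LinearMap.ker A ≤ LinearMap.ker Z := by
    intro a ha
    rw [LinearMap.mem_ker] at ha ⊢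
    rw [← norm_eq_zero, ← hAZ, ha, norm_zero]
  let L0 : LinearMap.range A →ₗ[ℝ] V := ((LinearMap.ker A).liftQ Z hker) ∘ₗ A.quotKerEquivRange.symm.toLinearMap
  have hL0 : ∀ a, L0 ⟨A a, LinearMap.mem_range_self A a⟩ = Z a := by
    intro a
    simp only [L0, LinearMap.comp_apply, LinearEquiv.coe_coe]
    rw [LinearMap.quotKerEquivRange_symm_apply_image]
    simp
  let L1 : LinearMap.range A →ₗᵢ[ℝ] V := ⟨L0, by
    rintro ⟨_, a, rfl⟩
    rw [hL0, ← hAZ]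
    rfl⟩
  refine ⟨L1.extend, fun t => ?_⟩
  have hu : u t = A (Pi.single t 1) := by simp [A, Fintype.linearCombination_apply_single]
  have hz : z t = Z (Pi.single t 1) := by simp [Z, Fintype.linearCombination_apply_single]
  rw [hu, hz, ← hL0]
  exact L1.extend_apply ⟨A (Pi.single t 1), LinearMap.mem_range_self A _⟩

theorem sim {d k : ℕ} (p b : Fin (k + 1) → Fin d → ℝ) (r : ℝ) (hr : 0 < r)
    (h : ∀ i j, eudist (b i) (b j) = r * eudist (p i) (p j)) :
    ∃ g : (Fin d → ℝ) → (Fin d → ℝ), IsSimilarity g ∧ ∀ t, b t = g (p t) := by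
  set x : Fin (k + 1) → EuclideanSpace ℝ (Fin d) := fun i => WithLp.toLp 2 (p i) with hx
  set y : Fin (k + 1) → EuclideanSpace ℝ (Fin d) := fun i => WithLp.toLp 2 (b i) with hy
  have hn : ∀ i j, ‖r⁻¹ • (y i - y j)‖ = ‖x i - x j‖ := by
    intro i j
    have := h i j
    rw [eudist_eq, eudist_eq] at this
    rw [norm_smul, this, norm_inv, Real.norm_of_nonneg hr.le]
    field_simp
    rfl
  obtain ⟨L, hL⟩ := iso_ext (fun t => x t - x 0) (fun t => r⁻¹ • (y t - y 0)) (fun s t => by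
    rw [real_inner_eq_norm_mul_self_add_norm_mul_self_sub_norm_sub_mul_self_div_two,
      real_inner_eq_norm_mul_self_add_norm_mul_self_sub_norm_sub_mul_self_div_two, hn, hn,
      ← smul_sub, sub_sub_sub_cancel_right, sub_sub_sub_cancel_right, hn])
  let L' : EuclideanSpace ℝ (Fin d) ≃ₗᵢ[ℝ] EuclideanSpace ℝ (Fin d) := L.toLinearIsometryEquiv rfl
  refine ⟨fun v => WithLp.ofLp (y 0 + r • L (WithLp.toLp 2 v - x 0)), ⟨⟨?_, ?_⟩, r, hr, ?_⟩, ?_⟩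
  · intro v v' hv
    have h1 := WithLp.ofLp_injective 2 hv
    have h2 := smul_right_injective _ hr.ne' (add_left_cancel h1)
    have h3 := L.injective h2
    exact WithLp.toLp_injective 2 (sub_left_inj.1 h3)
  · intro v
    refine ⟨WithLp.ofLp (x 0 + L'.symm (r⁻¹ • (WithLp.toLp 2 v - y 0))), ?_⟩
    have : ∀ z, L (L'.symm z) = z := fun z => L'.apply_symm_apply z
    simp only [WithLp.toLp_ofLp, add_sub_cancel_left, this, smul_smul]
    rw [mul_inv_cancel₀ hr.ne', one_smul, add_sub_cancel]
  · intro v v'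
    rw [eudist_eq, eudist_eq]
    simp only [WithLp.toLp_ofLp, add_sub_add_left_eq_sub, ← smul_sub, ← map_sub, sub_sub_sub_cancel_right]
    rw [norm_smul, Real.norm_of_nonneg hr.le, L.norm_map]
  · intro t
    have := hL t
    change b t = WithLp.ofLp (y 0 + r • L (x t - x 0))
    rw [this, smul_smul, mul_inv_cancel₀ hr.ne', one_smul, add_sub_cancel]
end CIC
end

section
namespace CIC
open MvPolynomial

theorem main9 {d n : ℕ} (hd : 2 ≤ d) (hn : d + 2 ≤ n) (G : Edge (d + 2) → Edge n → ℝ) (B : Edge n → Edge (d + 2) → ℝ)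
    (hG : ∀ e f, 0 ≤ G e f) (hB : ∀ y, LL G (fun f => ∑ e, B f e * y e) = y)
    (hfl : ∀ f x, PP (LL G (flip f x)) = PP (LL G x))
    (hvan : ∀ q : Fin n → Fin d → ℝ, PP (LL G (fun f => √(sqm q f))) = 0) :
    ∃ (ι : Fin (d + 2) → Fin n) (hι : Function.Injective ι) (s : ℝ), 0 < s ∧
      ∀ x e, LL G x e = s * x (emap ι hι e) := by
  obtain ⟨F, c, hF, hc, hL⟩ := step5 (by omega) G B hG hB hfl
  have sq0 : ∀ (q : Fin n → Fin d → ℝ) e, 0 ≤ sqm q e := by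
    intro q e
    obtain ⟨a, b, h, rfl⟩ := edge_ex e
    rw [sqm]
    exact Finset.sum_nonneg fun k _ => by rw [dl_edge]; positivity
  have H : ∀ q : Fin n → Fin d → ℝ, eval (sqm q) (TT F c) = 0 := by
    intro q
    rw [eval_TT, ← hvan q, PP]
    congr 2
    funext e
    rw [hL, mul_pow, Real.sq_sqrt (sq0 _ _)]
  obtain ⟨ι, hι, F', hF', hFF⟩ := step6 hn F hF c hc H
  have H' : ∀ q : Fin (d + 2) → Fin d → ℝ, eval (sqm q) (TT F' c) = 0 := by
    intro q
    have := H (Function.extend ι q 0)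
    rw [eval_TT] at this ⊢
    rw [← this]
    congr 2
    funext e
    congr 1
    rw [hFF]
    obtain ⟨a, b, h, he⟩ := edge_ex (F' e)
    rw [he, emap_edge]
    simp only [sqm, dl_edge, hι.extend_apply]
  obtain ⟨κ, hκ⟩ := ulem (TT F' c) (by simpa using TT_hom (by omega) F' c) H'
  obtain ⟨ι', hι', s, hs, hF'', hcs⟩ := step9 (by omega) F' hF'.1 c hc κ hκ
  refine ⟨ι ∘ ι', hι.comp hι', s, hs, fun x e => ?_⟩
  rw [hL, hcs, hFF, hF'']
  congr 2
  obtain ⟨a, b, h, rfl⟩ := edge_ex e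
  rfl
end CIC
end

section
namespace CIC
open MvPolynomial

section
variable {σ : Type*} [Fintype σ] [DecidableEq σ]

def oddS (a : σ →₀ ℕ) : Finset σ := Finset.univ.filter (fun i => a i % 2 = 1)
noncomputable def hlf (a : σ →₀ ℕ) : σ →₀ ℕ := a.mapRange (· / 2) rfl

noncomputable def par (Q : MvPolynomial σ ℚ) (S : Finset σ) : MvPolynomial σ ℚ :=
  ∑ a ∈ Q.support with oddS a = S, monomial (hlf a) (coeff a Q)

theorem par_eval {A : Type*} [CommRing A] [Algebra ℚ A] (Q : MvPolynomial σ ℚ) (x : σ → A) :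
    aeval x Q = ∑ S ∈ (Finset.univ : Finset σ).powerset, aeval (fun i => x i ^ 2) (par Q S) * ∏ i ∈ S, x i := by
  have h1 : aeval x Q = ∑ a ∈ Q.support, algebraMap ℚ A (coeff a Q) * ∏ i, x i ^ a i := by
    rw [aeval_def, eval₂_eq']
  rw [h1, ← Finset.sum_fiberwise_of_maps_to (g := oddS) (t := (Finset.univ : Finset σ).powerset)
    (fun a _ => by simp)]
  apply Finset.sum_congr rfl
  intro S _
  rw [par, map_sum, Finset.sum_mul]
  apply Finset.sum_congr rfl
  intro a ha
  obtain ⟨-, rfl⟩ := Finset.mem_filter.1 ha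
  rw [aeval_monomial, mul_assoc, Finsupp.prod_fintype _ _ (fun i => pow_zero _), oddS, Finset.prod_filter,
    ← Finset.prod_mul_distrib]
  congr 1
  apply Finset.prod_congr rfl
  intro i _
  rw [hlf, Finsupp.mapRange_apply, ← pow_mul]
  split_ifs with h
  · rw [← pow_succ]; congr 1; omega
  · rw [mul_one]; congr 1; omega

theorem par_hom (Q : MvPolynomial σ ℚ) (k : ℕ) (hQ : Q.IsHomogeneous k) (S : Finset σ) :
    (par Q S).IsHomogeneous ((k - S.card) / 2) := by
  rw [par]
  apply IsHomogeneous.sum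
  intro a ha
  obtain ⟨ha2, rfl⟩ := Finset.mem_filter.1 ha
  apply isHomogeneous_monomial
  have hd : a.degree = k := by
    rw [Finsupp.degree_eq_weight_one]
    exact hQ (mem_support_iff.1 ha2)
  have h1 : a.degree = ∑ i, a i := Finsupp.degree_eq_sum a
  have h2 : (hlf a).degree = ∑ i, a i / 2 := by
    rw [Finsupp.degree_eq_sum]; rfl
  have h3 : (oddS a).card = ∑ i, a i % 2 := by
    rw [oddS, Finset.card_filter]
    apply Finset.sum_congr rfl
    intro i _
    split_ifs <;> omega
  have h4 : ∑ i, a i = 2 * ∑ i, a i / 2 + ∑ i, a i % 2 := by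
    rw [Finset.mul_sum, ← Finset.sum_add_distrib]
    exact Finset.sum_congr rfl fun i _ => by omega
  omega

theorem par_deg (Q : MvPolynomial σ ℚ) (d : ℕ) (hQ : Q.IsHomogeneous (2 * (d + 1))) (S : Finset σ) (hS : S.Nonempty) :
    ∃ k ≤ d, (par Q S).IsHomogeneous k := by
  refine ⟨_, ?_, par_hom Q _ hQ S⟩
  have := hS.card_pos
  omega
end

theorem parity_main {n d : ℕ} (Q : MvPolynomial (Edge n) ℚ) (hQ : Q.IsHomogeneous (2 * (d + 1)))
    (H : ∀ S, ∀ q : Fin n → Fin d → ℝ, aeval (sqm q) (par Q S) = 0) (x : Edge n → ℝ) :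
    aeval x Q = aeval (fun i => x i ^ 2) (par Q ∅) := by
  rw [par_eval, Finset.sum_eq_single ∅]
  · simp
  · intro S _ hS
    obtain ⟨k, hk, hh⟩ := par_deg Q d hQ S (Finset.nonempty_iff_ne_empty.2 hS)
    have h0 : MvPolynomial.map (algebraMap ℚ ℝ) (par Q S) = 0 := by
      refine dgl (κ := Fin d) _ (hh.map _) (by simpa using hk) ?_
      intro q
      rw [eval_map, ← H S q, aeval_def]
    have h1 : aeval (fun i => x i ^ 2) (par Q S) = eval (fun i => x i ^ 2) (MvPolynomial.map (algebraMap ℚ ℝ) (par Q S)) := by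
      rw [eval_map, aeval_def]
    rw [h1, h0, map_zero, zero_mul]
  · simp

/-- signs -/
theorem signs {ι : Type*} [DecidableEq ι] (T : Finset ι) : ∀ g : Finset ι → ℝ,
    (∀ ε : ι → ℝ, (∀ i, ε i = 1 ∨ ε i = -1) → ∑ S ∈ T.powerset, g S * ∏ i ∈ S, ε i = 0) →
    ∀ S ⊆ T, g S = 0 := by
  induction T using Finset.induction_on with
  | empty =>
    intro g h S hS
    have := h (fun _ => 1) (fun _ => Or.inl rfl)
    rw [Finset.subset_empty.1 hS]
    simpa using this
  | insert i T hi ih =>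
    intro g h
    have key : ∀ δ : ℝ, (δ = 1 ∨ δ = -1) → ∀ S ⊆ T, g S + δ * g (insert i S) = 0 := by
      intro δ hδ
      apply ih (fun S => g S + δ * g (insert i S))
      intro ε hε
      have := h (fun j => if j = i then δ else ε j) (fun j => by split_ifs; exacts [hδ, hε j])
      rw [Finset.sum_powerset_insert hi, ← Finset.sum_add_distrib] at this
      rw [← this]
      apply Finset.sum_congr rfl
      intro S hS
      have hiS : i ∉ S := fun h => hi (Finset.mem_powerset.1 hS h)
      have e1 : ∏ j ∈ S, (if j = i then δ else ε j) = ∏ j ∈ S, ε j :=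
        Finset.prod_congr rfl fun j hj => if_neg (fun h => hiS (by rw [← h]; exact hj))
      rw [Finset.prod_insert hiS, e1, if_pos rfl]
      ring
    intro S hS
    by_cases hiS : i ∈ S
    · have hs : S.erase i ⊆ T := by
        intro j hj
        exact (Finset.mem_insert.1 (hS (Finset.mem_of_mem_erase hj))).resolve_left (Finset.ne_of_mem_erase hj)
      have h1 := key 1 (Or.inl rfl) _ hs
      have h2 := key (-1) (Or.inr rfl) _ hs
      rw [Finset.insert_erase hiS] at h1 h2
      linarith
    · have hs : S ⊆ T := by
        intro j hj
        exact (Finset.mem_insert.1 (hS hj)).resolve_left (fun h => hiS (h ▸ hj))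
      have h1 := key 1 (Or.inl rfl) _ hs
      have h2 := key (-1) (Or.inr rfl) _ hs
      linarith

def qext (K : Subfield ℝ) (b : ℝ) (hb : b ^ 2 ∈ K) (hbK : b ∉ K) : Subfield ℝ where
  carrier := {x | ∃ u ∈ K, ∃ v ∈ K, x = u + v * b}
  mul_mem' := by
    rintro _ _ ⟨u, hu, v, hv, rfl⟩ ⟨u', hu', v', hv', rfl⟩
    exact ⟨u * u' + v * v' * b ^ 2, K.add_mem (K.mul_mem hu hu') (K.mul_mem (K.mul_mem hv hv') hb),
      u * v' + v * u', K.add_mem (K.mul_mem hu hv') (K.mul_mem hv hu'), by ring⟩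
  one_mem' := ⟨1, K.one_mem, 0, K.zero_mem, by ring⟩
  add_mem' := by
    rintro _ _ ⟨u, hu, v, hv, rfl⟩ ⟨u', hu', v', hv', rfl⟩
    exact ⟨u + u', K.add_mem hu hu', v + v', K.add_mem hv hv', by ring⟩
  zero_mem' := ⟨0, K.zero_mem, 0, K.zero_mem, by ring⟩
  neg_mem' := by
    rintro _ ⟨u, hu, v, hv, rfl⟩
    exact ⟨-u, K.neg_mem hu, -v, K.neg_mem hv, by ring⟩
  inv_mem' := by
    rintro _ ⟨u, hu, v, hv, rfl⟩
    by_cases h0 : u + v * b = 0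
    · rw [h0, inv_zero]
      exact ⟨0, K.zero_mem, 0, K.zero_mem, by ring⟩
    have h1 : u - v * b ≠ 0 := by
      intro h
      by_cases hv0 : v = 0
      · subst hv0; simp at h h0; exact h0 h
      · apply hbK
        have : b = u / v := by field_simp; linarith
        rw [this]
        exact K.div_mem hu hv
    have hN : u ^ 2 - v ^ 2 * b ^ 2 ≠ 0 := by
      have : u ^ 2 - v ^ 2 * b ^ 2 = (u + v * b) * (u - v * b) := by ring
      rw [this]
      exact mul_ne_zero h0 h1
    have hNK : u ^ 2 - v ^ 2 * b ^ 2 ∈ K := K.sub_mem (K.pow_mem hu 2) (K.mul_mem (K.pow_mem hv 2) hb)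
    refine ⟨u / (u ^ 2 - v ^ 2 * b ^ 2), K.div_mem hu hNK, -v / (u ^ 2 - v ^ 2 * b ^ 2), K.div_mem (K.neg_mem hv) hNK, ?_⟩
    rw [inv_eq_iff_eq_inv, eq_comm, inv_eq_iff_eq_inv, eq_comm]
    apply inv_eq_of_mul_eq_one_left
    field_simp
    ring

theorem bes {ι : Type*} [DecidableEq ι] (b : ι → ℝ) (T : Finset ι) : ∀ K : Subfield ℝ, (∀ i ∈ T, b i ^ 2 ∈ K) →
    (∀ S ⊆ T, S.Nonempty → ∏ i ∈ S, b i ∉ K) → ∀ c : Finset ι → ℝ, (∀ S ⊆ T, c S ∈ K) →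
    ∑ S ∈ T.powerset, c S * ∏ i ∈ S, b i = 0 → ∀ S ⊆ T, c S = 0 := by
  induction T using Finset.induction_on with
  | empty =>
    intro K _ _ c _ h S hS
    rw [Finset.subset_empty.1 hS]
    simpa using h
  | insert i T hi ih =>
    intro K hK hP c hc h
    have hbi : b i ^ 2 ∈ K := hK i (Finset.mem_insert_self _ _)
    have hbK : b i ∉ K := by
      have := hP {i} (by simp) (by simp)
      simpa using this
    have key : ∀ S ⊆ T, c S + c (insert i S) * b i = 0 := by
      refine ih (qext K (b i) hbi hbK) ?_ ?_ (fun S => c S + c (insert i S) * b i) ?_ ?_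
      · intro j hj
        exact ⟨_, hK j (Finset.mem_insert_of_mem hj), 0, K.zero_mem, by ring⟩
      · rintro S hS hne ⟨x, hx, y, hy, hxy⟩
        have hM : (∏ j ∈ S, b j) ^ 2 ∈ K := by
          rw [← Finset.prod_pow]
          exact K.prod_mem fun j hj => hK j (Finset.mem_insert_of_mem (hS hj))
        have hiS : i ∉ S := fun h => hi (hS h)
        by_cases hy0 : y = 0
        · subst hy0
          apply hP S (hS.trans (Finset.subset_insert _ _)) hne
          rw [hxy]; simpa using hx
        by_cases hx0 : x = 0
        · subst hx0
          apply hP (insert i S) (Finset.insert_subset_insert _ hS) (by simp)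
          rw [Finset.prod_insert hiS, hxy]
          have : b i * (0 + y * b i) = y * b i ^ 2 := by ring
          rw [this]
          exact K.mul_mem hy hbi
        apply hbK
        have : b i = ((∏ j ∈ S, b j) ^ 2 - x ^ 2 - y ^ 2 * b i ^ 2) / (2 * x * y) := by
          rw [hxy]; field_simp; ring
        rw [this]
        have h2 : (2 : ℝ) ∈ K := ofNat_mem K 2
        exact K.div_mem (K.sub_mem (K.sub_mem hM (K.pow_mem hx 2)) (K.mul_mem (K.pow_mem hy 2) hbi))
          (K.mul_mem (K.mul_mem h2 hx) hy)
      · intro S hS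
        exact ⟨_, hc S (hS.trans (Finset.subset_insert _ _)), _, hc _ (Finset.insert_subset_insert _ hS), rfl⟩
      · rw [Finset.sum_powerset_insert hi, ← Finset.sum_add_distrib] at h
        rw [← h]
        apply Finset.sum_congr rfl
        intro S hS
        have hiS : i ∉ S := fun h => hi (Finset.mem_powerset.1 hS h)
        rw [Finset.prod_insert hiS]
        ring
    have key2 : ∀ S ⊆ T, c (insert i S) = 0 ∧ c S = 0 := by
      intro S hS
      have h1 := key S hS
      have h2 : c (insert i S) = 0 := by
        by_contra hne
        apply hbK
        have : b i = - c S / c (insert i S) := by field_simp; linarith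
        rw [this]
        exact K.div_mem (K.neg_mem (hc S (hS.trans (Finset.subset_insert _ _)))) (hc _ (Finset.insert_subset_insert _ hS))
      rw [h2] at h1
      exact ⟨h2, by linarith⟩
    intro S hS
    by_cases hiS : i ∈ S
    · have hs : S.erase i ⊆ T := by
        intro j hj
        exact (Finset.mem_insert.1 (hS (Finset.mem_of_mem_erase hj))).resolve_left (Finset.ne_of_mem_erase hj)
      have := (key2 _ hs).1
      rwa [Finset.insert_erase hiS] at this
    · have hs : S ⊆ T := by
        intro j hj
        exact (Finset.mem_insert.1 (hS hj)).resolve_left (fun h => hiS (h ▸ hj))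
      exact (key2 _ hs).2
end CIC
end

section
namespace CIC
open MvPolynomial

theorem map_sqm {R A κ : Type*} [CommRing R] [CommRing A] [Fintype κ] {n : ℕ} (φ : R →+* A) (q : Fin n → κ → R)
    (e : Edge n) : φ (sqm q e) = sqm (fun i k => φ (q i k)) e := by
  obtain ⟨a, b, h, rfl⟩ := edge_ex e
  simp [sqm, dl_edge]

noncomputable def qQ (n d : ℕ) : Fin n → Fin d → MvPolynomial (Fin n × Fin d) ℚ := fun i k => X (i, k)

theorem aeval_qQ {A : Type*} [CommRing A] [Algebra ℚ A] {n d : ℕ} (q : Fin n → Fin d → A) (e : Edge n) :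
    aeval (fun ik : Fin n × Fin d => q ik.1 ik.2) (sqm (qQ n d) e) = sqm q e := by
  have := map_sqm (aeval (R := ℚ) (fun ik : Fin n × Fin d => q ik.1 ik.2)).toRingHom (qQ n d) e
  simp only [AlgHom.toRingHom_eq_coe, RingHom.coe_coe, qQ, aeval_X] at this
  exact this

theorem not_sq {n d : ℕ} (hd : 2 ≤ d) (S : Finset (Edge n)) (hS : S.Nonempty) (c : MvPolynomial (Fin n × Fin d) ℚ)
    (hc : ∏ e ∈ S, sqm (qQ n d) e = c ^ 2) : False := by
  obtain ⟨e0, he0⟩ := hS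
  obtain ⟨i, j, hij, rfl⟩ := edge_ex e0
  set x0 : Fin d := ⟨0, by omega⟩
  set x1 : Fin d := ⟨1, by omega⟩
  have hx : x0 ≠ x1 := by simp [x0, x1]
  set q : Fin n → Fin d → Polynomial ℂ := fun k x =>
    if k = i then (if x = x0 then Polynomial.X else if x = x1 then 1 else 0) else
      if k = j then 0 else (if x = x0 then Polynomial.C ((k : ℂ) + 1) else 0) with hq
  have hq0 : ∀ k x, x ≠ x0 → x ≠ x1 → q k x = 0 := by
    intro k x h0 h1
    simp only [hq, if_neg h0, if_neg h1]
    split_ifs <;> rfl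
  have hs : ∀ a b (h : a ≠ b), sqm q (edge a b h) = (q a x0 - q b x0) ^ 2 + (q a x1 - q b x1) ^ 2 := by
    intro a b h
    simp only [sqm, dl_edge]
    apply Fintype.sum_eq_add x0 x1 hx
    rintro x ⟨h0, h1⟩
    rw [hq0 _ _ h0 h1, hq0 _ _ h0 h1]; simp
  have hs0 : sqm q (edge i j hij) = Polynomial.X ^ 2 + 1 := by
    rw [hs]
    simp [hq, hij.symm, hx.symm]
  have hII : Complex.I ^ 2 = -1 := Complex.I_sq
  have hne' : ∀ a b (h : a ≠ b), edge a b h ≠ edge i j hij → b ≠ i → (sqm q (edge a b h)).eval Complex.I ≠ 0 := by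
    intro a b h hne hb
    rw [hs]
    by_cases ha : a = i
    · subst ha
      have hbj : b ≠ j := by rintro rfl; exact hne rfl
      simp [hq, hb, hbj, hx.symm]
      intro h0
      have h1 := congrArg Complex.im h0
      simp [pow_two] at h1
      have : ((b : ℕ) : ℝ) + 1 ≠ 0 := by positivity
      apply this
      linarith
    · have hcast : ((a : ℕ) : ℂ) ≠ ((b : ℕ) : ℂ) := by
        intro h'; exact h (Fin.ext (by exact_mod_cast h'))
      have hp : ∀ k : Fin n, ((k : ℕ) : ℂ) + 1 ≠ 0 := fun k => Nat.cast_add_one_ne_zero _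
      by_cases haj : a = j
      · subst haj
        simp [hq, hb, ha, hx.symm, h.symm]
        have := hp b
        intro h'; apply this; linear_combination -h'
      · by_cases hbj : b = j
        · subst hbj
          simp [hq, hb, ha, hx.symm, h]
          exact hp a
        · simp [hq, hb, ha, hx.symm, haj, hbj]
          exact sub_ne_zero.2 hcast
  have hne : ∀ e, e ≠ edge i j hij → (sqm q e).eval Complex.I ≠ 0 := by
    intro e he
    obtain ⟨a, b, h, rfl⟩ := edge_ex e
    by_cases hb : b = i
    · rw [edge_comm] at he ⊢
      exact hne' b a h.symm he (by rw [← hb]; exact h)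
    · exact hne' a b h he hb
  have h1 := congrArg (aeval (fun ik : Fin n × Fin d => q ik.1 ik.2)) hc
  rw [map_prod, map_pow] at h1
  simp only [aeval_qQ] at h1
  rw [← Finset.mul_prod_erase _ _ he0, hs0] at h1
  set r := aeval (fun ik : Fin n × Fin d => q ik.1 ik.2) c
  have h2 := congrArg (Polynomial.eval Complex.I) h1
  simp at h2
  have h3 := congrArg (fun p => (Polynomial.derivative p).eval Complex.I) h1
  have h2' : Polynomial.eval Complex.I r = 0 := by
    rw [eq_comm] at h2
    exact pow_eq_zero_iff two_ne_zero |>.1 h2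
  simp [Polynomial.derivative_pow, h2', Polynomial.eval_prod] at h3
  have h3 := Finset.prod_eq_zero_iff.1 h3
  obtain ⟨e, he, h4⟩ := h3
  exact hne e (Finset.ne_of_mem_erase he) h4

theorem irr {n d : ℕ} (hd : 2 ≤ d) (p : Fin n → Fin d → ℝ) (hp : GenericConfig p) (S : Finset (Edge n))
    (hS : S.Nonempty) :
    ∏ e ∈ S, √(sqm p e) ∉ IntermediateField.adjoin ℚ (Set.range (fun ik : Fin n × Fin d => p ik.1 ik.2)) := by
  intro hmem
  rw [IntermediateField.mem_adjoin_range_iff] at hmem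
  obtain ⟨a, b, hab⟩ := hmem
  have sq0 : ∀ e, 0 ≤ sqm p e := by
    intro e
    obtain ⟨a, b, h, rfl⟩ := edge_ex e
    rw [sqm]
    exact Finset.sum_nonneg fun k _ => by rw [dl_edge]; positivity
  have hinj : ∀ f g : MvPolynomial (Fin n × Fin d) ℚ, aeval (fun ik : Fin n × Fin d => p ik.1 ik.2) f =
      aeval (fun ik : Fin n × Fin d => p ik.1 ik.2) g → f = g := by
    intro f g h
    by_contra hne
    apply hp (f - g) (sub_ne_zero.2 hne)
    rw [map_sub, h, sub_self]
  have hM : aeval (fun ik : Fin n × Fin d => p ik.1 ik.2) (∏ e ∈ S, sqm (qQ n d) e) = (∏ e ∈ S, √(sqm p e)) ^ 2 := by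
    rw [map_prod, ← Finset.prod_pow]
    apply Finset.prod_congr rfl
    intro e _
    rw [aeval_qQ, Real.sq_sqrt (sq0 e)]
  have hMne : ∏ e ∈ S, sqm (qQ n d) e ≠ 0 := by
    intro h
    apply not_sq hd S hS 0
    rw [h]; ring
  have hb : b ≠ 0 := by
    rintro rfl
    rw [map_zero, div_zero] at hab
    apply hp _ hMne
    rw [hM, hab]; ring
  have hb' := hp b hb
  have h1 : (∏ e ∈ S, sqm (qQ n d) e) * b ^ 2 = a ^ 2 := by
    apply hinj
    rw [map_mul, hM, hab, map_pow, map_pow]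
    field_simp
  have h2 : b ∣ a := by
    rw [← UniqueFactorizationMonoid.pow_dvd_pow_iff_dvd two_ne_zero]
    exact ⟨_, by rw [← h1]; ring⟩
  obtain ⟨c, rfl⟩ := h2
  apply not_sq hd S hS c
  have : b ^ 2 ≠ 0 := pow_ne_zero 2 hb
  apply mul_right_cancel₀ this
  rw [h1]; ring

theorem caseA {n d : ℕ} (hd : 2 ≤ d) (p : Fin n → Fin d → ℝ) (hp : GenericConfig p) (Q : MvPolynomial (Edge n) ℚ)
    (hQ : aeval (fun e => √(sqm p e)) Q = 0) (S : Finset (Edge n)) (q : Fin n → Fin d → ℝ) :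
    aeval (sqm q) (par Q S) = 0 := by
  set K := IntermediateField.adjoin ℚ (Set.range (fun ik : Fin n × Fin d => p ik.1 ik.2)) with hK
  have sq0 : ∀ e, 0 ≤ sqm p e := by
    intro e
    obtain ⟨a, b, h, rfl⟩ := edge_ex e
    rw [sqm]
    exact Finset.sum_nonneg fun k _ => by rw [dl_edge]; positivity
  have hmemK : ∀ f : MvPolynomial (Fin n × Fin d) ℚ, aeval (fun ik : Fin n × Fin d => p ik.1 ik.2) f ∈ K := by
    intro f
    rw [hK, IntermediateField.mem_adjoin_range_iff]
    exact ⟨f, 1, by simp⟩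
  have hcomp : ∀ (q : Fin n → Fin d → ℝ) (f : MvPolynomial (Edge n) ℚ),
      aeval (fun ik : Fin n × Fin d => q ik.1 ik.2) (aeval (sqm (qQ n d)) f) = aeval (sqm q) f := by
    intro q f
    rw [← AlgHom.comp_apply, comp_aeval]
    congr 2
    funext e
    exact aeval_qQ q e
  rw [par_eval] at hQ
  simp only [Real.sq_sqrt (sq0 _)] at hQ
  have h1 := bes (fun e => √(sqm p e)) Finset.univ K.toSubfield (fun e _ => by
      rw [Real.sq_sqrt (sq0 e), ← aeval_qQ]
      exact hmemK _)
    (fun S _ hS => irr hd p hp S hS) (fun S => aeval (sqm p) (par Q S)) (fun S _ => by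
      rw [← hcomp]
      exact hmemK _) hQ S (Finset.subset_univ _)
  beta_reduce at h1
  rw [← hcomp] at h1 ⊢
  have h2 : aeval (sqm (qQ n d)) (par Q S) = 0 := by
    by_contra hne
    exact hp _ hne h1
  rw [h2, map_zero]
end CIC
end

section
namespace CIC
open MvPolynomial

theorem sqm_nn {n d : ℕ} (p : Fin n → Fin d → ℝ) (e : Edge n) : 0 ≤ sqm p e := by
  obtain ⟨a, b, h, rfl⟩ := edge_ex e
  rw [sqm]
  exact Finset.sum_nonneg fun k _ => by rw [dl_edge]; positivity

theorem lenR_sqm {n d : ℕ} (p : Fin n → Fin d → ℝ) (e : Edge n) : lenR p e.val = √(sqm p e) := by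
  obtain ⟨a, b, h, rfl⟩ := edge_ex e
  rfl

theorem cSq_sqm {n d : ℕ} (p : Fin n → Fin d → ℂ) (e : Edge n) : cSqLen p e.val = sqm p e := by
  obtain ⟨a, b, h, rfl⟩ := edge_ex e
  rfl

theorem aeval_ofReal {σ : Type*} (x : σ → ℝ) (Q : MvPolynomial σ ℚ) :
    aeval (fun i => ((x i : ℝ) : ℂ)) Q = ((aeval x Q : ℝ) : ℂ) := by
  have := aeval_algebraMap_apply (R := ℚ) ℂ x Q
  exact this

theorem caseB {n d : ℕ} (hd : 2 ≤ d) (p : Fin n → Fin d → ℝ)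
    (hp : IsGenericPt (Lvar d n) (fun e : Edge n => ((lenR p e.val : ℝ) : ℂ))) (Q : MvPolynomial (Edge n) ℚ)
    (hQ : aeval (fun e => √(sqm p e)) Q = 0) (S : Finset (Edge n)) (q : Fin n → Fin d → ℝ) :
    aeval (sqm q) (par Q S) = 0 := by
  have hvan := hp.2 Q (by
    simp only [lenR_sqm]
    rw [aeval_ofReal, hQ, Complex.ofReal_zero])
  have hx : ∀ (q : Fin n → Fin d → ℝ) (ε : Edge n → ℝ), (∀ i, ε i = 1 ∨ ε i = -1) →
      aeval (fun e => ε e * √(sqm q e)) Q = 0 := by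
    intro q ε hε
    have := hvan (fun e => ((ε e * √(sqm q e) : ℝ) : ℂ)) (by
      refine ⟨fun i k => (q i k : ℂ), fun e => ?_⟩
      rw [cSq_sqm]
      have h1 : (sqm (fun i k => (q i k : ℂ)) e) = ((sqm q e : ℝ) : ℂ) :=
        (map_sqm Complex.ofRealHom q e).symm
      rw [h1, sqMap, ← Complex.ofReal_pow, mul_pow, Real.sq_sqrt (sqm_nn q e)]
      rcases hε e with h | h <;> rw [h] <;> simp)
    rw [aeval_ofReal] at this
    exact_mod_cast this
  have hg : ∀ (q : Fin n → Fin d → ℝ), (∏ e ∈ S, sqm q e) * aeval (sqm q) (par Q S) = 0 := by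
    intro q
    have h1 := signs Finset.univ (fun S => aeval (sqm q) (par Q S) * ∏ e ∈ S, √(sqm q e)) (by
      intro ε hε
      have h2 := hx q ε hε
      rw [par_eval] at h2
      rw [← h2]
      apply Finset.sum_congr rfl
      intro S _
      have h3 : (fun i => (ε i * √(sqm q i)) ^ 2) = sqm q := by
        funext i
        rw [mul_pow, Real.sq_sqrt (sqm_nn q i)]
        rcases hε i with h | h <;> rw [h] <;> ring
      rw [h3, Finset.prod_mul_distrib]
      ring) S (Finset.subset_univ _)
    beta_reduce at h1
    have h4 : ∏ e ∈ S, sqm q e = (∏ e ∈ S, √(sqm q e)) * ∏ e ∈ S, √(sqm q e) := by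
      rw [← Finset.prod_mul_distrib]
      exact Finset.prod_congr rfl fun e _ => (Real.mul_self_sqrt (sqm_nn q e)).symm
    rw [h4, mul_assoc, mul_comm _ (aeval _ _), h1, mul_zero]
  have hcomp : ∀ (q : Fin n → Fin d → ℝ) (f : MvPolynomial (Edge n) ℚ),
      aeval (fun ik : Fin n × Fin d => q ik.1 ik.2) (aeval (sqm (qQ n d)) f) = aeval (sqm q) f := by
    intro q f
    rw [← AlgHom.comp_apply, comp_aeval]
    congr 2
    funext e
    exact aeval_qQ q e
  rcases S.eq_empty_or_nonempty with rfl | hS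
  · simpa using hg q
  have hMne : ∏ e ∈ S, sqm (qQ n d) e ≠ 0 := by
    intro h
    apply not_sq hd S hS 0
    rw [h]; ring
  have hz : (∏ e ∈ S, sqm (qQ n d) e) * aeval (sqm (qQ n d)) (par Q S) = 0 := by
    apply map_injective (algebraMap ℚ ℝ) (algebraMap ℚ ℝ).injective
    apply MvPolynomial.funext
    intro x
    rw [map_zero, map_zero, eval_map, ← aeval_def, map_mul, map_prod]
    have h5 := hcomp (fun i k => x (i, k)) (par Q S)
    have h6 : ∀ e, aeval x (sqm (qQ n d) e) = sqm (fun i k => x (i, k)) e := fun e =>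
      aeval_qQ (fun i k => x (i, k)) e
    have h7 : aeval x (aeval (sqm (qQ n d)) (par Q S)) = aeval (sqm fun i k => x (i, k)) (par Q S) := h5
    rw [h7]
    simp only [h6]
    exact hg _
  rw [← hcomp, (mul_eq_zero.1 hz).resolve_left hMne, map_zero]

noncomputable def QQ {k n : ℕ} (γ : Edge k → Edge n → ℚ) : MvPolynomial (Edge n) ℚ :=
  aeval (fun e => (∑ f, C (γ e f) * X f) ^ 2) (Pm ℚ k)

theorem QQ_hom {k n : ℕ} (hk : 1 ≤ k) (γ : Edge k → Edge n → ℚ) : (QQ γ).IsHomogeneous (2 * (k - 1)) := by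
  rw [QQ]
  apply (Pm_hom ℚ k hk).aeval
  intro e
  have h : (∑ f, C (γ e f) * X f : MvPolynomial (Edge n) ℚ).IsHomogeneous 1 := by
    apply IsHomogeneous.sum
    intro f _
    simpa using (isHomogeneous_C (Edge n) (γ e f)).mul (isHomogeneous_X ℚ f)
  simpa using h.pow 2

theorem QQ_aeval {k n : ℕ} (γ : Edge k → Edge n → ℚ) (x : Edge n → ℝ) :
    aeval x (QQ γ) = PP (LL (fun e f => (γ e f : ℝ)) x) := by
  rw [QQ, PP, ← AlgHom.comp_apply, comp_aeval, aeval_Pm, eval_Pm]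
  congr 2
  funext e
  simp [LL]

theorem right_inv {k n : ℕ} (γ : Edge k → Edge n → ℚ) (hli : LinearIndependent ℚ γ) :
    ∃ B : Edge n → Edge k → ℝ, ∀ y, LL (fun e f => (γ e f : ℝ)) (fun f => ∑ e, B f e * y e) = y := by
  have h1 : (Matrix.of γ).rank = Fintype.card (Edge k) := LinearIndependent.rank_matrix (M := Matrix.of γ) hli
  have h2 : Function.Surjective (Matrix.of γ).mulVec := by
    have : LinearMap.range (Matrix.of γ).mulVecLin = ⊤ := by
      apply Submodule.eq_top_of_finrank_eq
      rw [Module.finrank_fintype_fun_eq_card, ← h1]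
      rfl
    exact LinearMap.range_eq_top.1 this
  obtain ⟨B, hB⟩ := Matrix.mulVec_surjective_iff_exists_right_inverse.1 h2
  refine ⟨fun f e => (B f e : ℝ), fun y => ?_⟩
  funext e
  have h3 : ∀ e', ∑ f, (γ e f : ℝ) * (B f e' : ℝ) = if e = e' then 1 else 0 := by
    intro e'
    have := congrFun (congrFun hB e) e'
    rw [Matrix.mul_apply, Matrix.one_apply] at this
    simp only [Matrix.of_apply] at this
    have h := congrArg (fun t : ℚ => (t : ℝ)) this
    push_cast at h
    rw [h]
    split_ifs <;> simp
  simp only [LL, Finset.mul_sum]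
  rw [Finset.sum_comm]
  simp only [← mul_assoc, ← Finset.sum_mul, h3]
  simp

theorem final
    {d n : ℕ} (hd : 2 ≤ d) (hn : d + 2 ≤ n)
    (w : Edge (d + 2) → ℂ) (hrank : LinearIndependent ℚ w)
    (hw : w ∈ Lvar d (d + 2))
    (p : Fin n → Fin d → ℝ)
    (hp : GenericConfig p ∨
      IsGenericPt (Lvar d n) (fun e : Edge n => ((lenR p e.val : ℝ) : ℂ)))
    (γ : Edge (d + 2) → Edge n → ℚ) (hγ : ∀ e f, 0 ≤ γ e f)
    (hwγ : ∀ e, w e = ((∑ f : Edge n, (γ e f : ℝ) * lenR p f.val : ℝ) : ℂ)) :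
    ∃ (ι : Fin (d + 2) → Fin n) (s : ℝ), Function.Injective ι ∧ 0 < s ∧
      (∀ e : Edge (d + 2), w e = ((s * lenR (fun t => p (ι t)) e.val : ℝ) : ℂ)) ∧
      (∀ (b : Fin (d + 2) → Fin d → ℝ) (s' : ℝ), 0 < s' →
        (∀ e : Edge (d + 2), w e = ((s' * lenR b e.val : ℝ) : ℂ)) →
        ∃ g : (Fin d → ℝ) → (Fin d → ℝ), IsSimilarity g ∧
          ∀ t, b t = g (p (ι t))) := by
  have hwL : ∀ e, w e = ((LL (fun e f => (γ e f : ℝ)) (fun f => √(sqm p f)) e : ℝ) : ℂ) := by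
    intro e
    rw [hwγ e]
    simp only [lenR_sqm, LL]
  have hQ0 : aeval (fun e => √(sqm p e)) (QQ γ) = 0 := by
    rw [QQ_aeval, PP]
    obtain ⟨q, hq⟩ := hw
    have h1 := det_M (K := ℂ) (by simp) q
    rw [← aeval_Pm (R := ℚ)] at h1
    have h2 : sqm q = fun e => ((LL (fun e f => (γ e f : ℝ)) (fun f => √(sqm p f)) e ^ 2 : ℝ) : ℂ) := by
      funext e
      rw [← cSq_sqm, ← hq e, sqMap, hwL e, Complex.ofReal_pow]
    rw [h2, aeval_ofReal, aeval_Pm] at h1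
    rw [eval_Pm]
    exact_mod_cast h1
  have H : ∀ S, ∀ q : Fin n → Fin d → ℝ, aeval (sqm q) (par (QQ γ) S) = 0 := by
    intro S q
    rcases hp with hp | hp
    · exact caseA hd p hp _ hQ0 S q
    · exact caseB hd p hp _ hQ0 S q
  have hpar : ∀ x : Edge n → ℝ, PP (LL (fun e f => (γ e f : ℝ)) x) = aeval (fun i => x i ^ 2) (par (QQ γ) ∅) := by
    intro x
    rw [← QQ_aeval]
    exact parity_main (d := d) (QQ γ) (QQ_hom (by omega) γ) H x
  have hli : LinearIndependent ℚ γ := by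
    rw [Fintype.linearIndependent_iff] at hrank ⊢
    intro g hg
    apply hrank g
    have h1 : ∀ f, ∑ e, (g e : ℝ) * (γ e f : ℝ) = 0 := by
      intro f
      have := congrFun hg f
      simp only [Finset.sum_apply, Pi.smul_apply, smul_eq_mul, Pi.zero_apply] at this
      exact_mod_cast this
    have h2 : ∑ e, (g e : ℝ) * ∑ f : Edge n, (γ e f : ℝ) * lenR p f.val = 0 := by
      simp only [Finset.mul_sum, ← mul_assoc]
      rw [Finset.sum_comm]
      simp only [← Finset.sum_mul, h1]
      simp
    have h3 := congrArg (fun t : ℝ => (t : ℂ)) h2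
    simp only [hwγ, Algebra.smul_def]
    push_cast at h3 ⊢
    simpa using h3
  obtain ⟨B, hB⟩ := right_inv γ hli
  obtain ⟨ι, hι, s, hs, hL⟩ := main9 hd hn (fun e f => (γ e f : ℝ)) B (fun e f => by exact_mod_cast hγ e f) hB
    (fun f x => by rw [hpar, hpar, flip_sq])
    (fun q => by
      rw [hpar]
      simp only [Real.sq_sqrt (sqm_nn q _)]
      exact H ∅ q)
  have hres : ∀ e : Edge (d + 2), w e = ((s * lenR (fun t => p (ι t)) e.val : ℝ) : ℂ) := by
    intro e
    rw [hwL, hL]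
    congr 2
    obtain ⟨a, b, h, rfl⟩ := edge_ex e
    rfl
  refine ⟨ι, s, hι, hs, hres, ?_⟩
  intro b s' hs' hb
  apply sim (fun t => p (ι t)) b (s / s') (by positivity)
  intro i j
  by_cases hij : i = j
  · subst hij; simp [eudist]
  · have h1 := hres (edge i j hij)
    rw [hb, Complex.ofReal_inj] at h1
    have h2 : s' * eudist (b i) (b j) = s * eudist (p (ι i)) (p (ι j)) := h1
    field_simp
    linarith
end CIC
end

/-- **consistency implies correctness.**  Let `d ≥ 2` and
`D = C(d+2,2)`.  Let `w ∈ ℂ^D` (indexed by the edges of `K_{d+2}`) have rational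
rank `D` — i.e. its `D` entries are linearly independent over ℚ — and lie on
`L_{d,d+2}`.  Suppose there is a configuration `p` of `n` points in ℝ^d that is
generic (or simply such that `l(p)` is generic in `L_{d,n}`), together with `D`
non-negative rational length functionals `γ_e` with `w e = ⟨γ_e, p⟩` for all
`e`.  Then there is a `(d+2)`-point subconfiguration `p_T` of `p` and a positive
scale `s` with `⟨γ, p⟩ = w = s · l(p_T)`; moreover `w` determines `p_T` up to a
similarity transform of ℝ^d. -/
theorem consistency_implies_correctness
    {d n : ℕ} (hd : 2 ≤ d) (hn : d + 2 ≤ n)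
    (w : Edge (d + 2) → ℂ) (hrank : LinearIndependent ℚ w)
    (hw : w ∈ Lvar d (d + 2))
    (p : Fin n → Fin d → ℝ)
    (hp : GenericConfig p ∨
      IsGenericPt (Lvar d n) (fun e : Edge n => ((lenR p e.val : ℝ) : ℂ)))
    (γ : Edge (d + 2) → Edge n → ℚ) (hγ : ∀ e f, 0 ≤ γ e f)
    (hwγ : ∀ e, w e = ((∑ f : Edge n, (γ e f : ℝ) * lenR p f.val : ℝ) : ℂ)) :
    ∃ (ι : Fin (d + 2) → Fin n) (s : ℝ), Function.Injective ι ∧ 0 < s ∧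
      (∀ e : Edge (d + 2), w e = ((s * lenR (fun t => p (ι t)) e.val : ℝ) : ℂ)) ∧
      (∀ (b : Fin (d + 2) → Fin d → ℝ) (s' : ℝ), 0 < s' →
        (∀ e : Edge (d + 2), w e = ((s' * lenR b e.val : ℝ) : ℂ)) →
        ∃ g : (Fin d → ℝ) → (Fin d → ℝ), IsSimilarity g ∧
          ∀ t, b t = g (p (ι t))) := by
  exact CIC.final hd hn w hrank hw p hp γ hγ hwγ
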